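/- arXiv:1605.05626 — 5 statements merged into one kernel-verified Lean document; each statement's English description precedes it below -/
import Mathlib

section
/- Every invertible n×n complex matrix is a product of 2n companion matrices. -/
/-- An `n×n` matrix is a companion matrix: for every column `j < n-1`, the column is the
standard basis vector `e_{j+1}`; the last column is arbitrary. -/
def IsCompanion (n : ℕ) (C : Matrix (Fin n) (Fin n) ℂ) : Prop :=
  ∀ i j : Fin n, (j : ℕ) < n - 1 →
    C i j = if (i : ℕ) = (j : ℕ) + 1 then 1 else 0

/-- The matrix whose first `k` columns are those of `M` and whose other columns are those of the
identity matrix. -/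
def leadingColumns {n : ℕ} (M : Matrix (Fin n) (Fin n) ℂ) (k : ℕ) : Matrix (Fin n) (Fin n) ℂ :=
  fun i j => if (j : ℕ) < k then M i j else (1 : Matrix (Fin n) (Fin n) ℂ) i j

theorem leadingColumns_zero {n : ℕ} (M : Matrix (Fin n) (Fin n) ℂ) : leadingColumns M 0 = 1 := by
  ext i j
  simp [leadingColumns]

theorem leadingColumns_self {n : ℕ} (M : Matrix (Fin n) (Fin n) ℂ) : leadingColumns M n = M := by
  ext i j
  simp [leadingColumns]

theorem leadingColumns_updateCol_of_le {n : ℕ} (M : Matrix (Fin n) (Fin n) ℂ) (p : Fin n)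
    (v : Fin n → ℂ) {k : ℕ} (hk : k ≤ p) :
    leadingColumns (M.updateCol p v) k = leadingColumns M k := by
  ext i j
  simp only [leadingColumns, Matrix.updateCol_apply]
  split_ifs with h1 h2
  · subst h2; omega
  · rfl
  · rfl

theorem leadingColumns_updateCol_succ {n : ℕ} (M : Matrix (Fin n) (Fin n) ℂ) (p : Fin n)
    (v : Fin n → ℂ) :
    leadingColumns (M.updateCol p v) (p + 1) = (leadingColumns M p).updateCol p v := by
  ext i j
  simp only [leadingColumns, Matrix.updateCol_apply]
  by_cases h : j = p
  · simp [h]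
  · have : (j : ℕ) ≠ p := fun h' => h (Fin.ext h')
    have h2 : (j : ℕ) < p + 1 ↔ (j : ℕ) < p := by omega
    simp [h, h2]

/-- The companion matrix with last column `c`. -/
def companionOf {m : ℕ} (c : Fin (m + 1) → ℂ) : Matrix (Fin (m + 1)) (Fin (m + 1)) ℂ :=
  fun i j => if j = Fin.last m then c i else if i = j + 1 then 1 else 0

theorem isCompanion_companionOf {m : ℕ} (c : Fin (m + 1) → ℂ) :
    IsCompanion (m + 1) (companionOf c) := by
  intro i j hj
  have hj' : j ≠ Fin.last m := by
    rintro rfl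
    simp at hj
  have h1 : ((j + 1 : Fin (m + 1)) : ℕ) = j + 1 := Fin.val_add_one_of_lt (by
    rw [Fin.lt_def, Fin.val_last]; omega)
  simp [companionOf, hj', Fin.ext_iff, h1]

theorem mul_companionOf_last {m : ℕ} (N : Matrix (Fin (m + 1)) (Fin (m + 1)) ℂ)
    (c : Fin (m + 1) → ℂ) (i : Fin (m + 1)) :
    (N * companionOf c) i (Fin.last m) = (N.mulVec c) i := by
  simp [Matrix.mul_apply, companionOf, Matrix.mulVec, dotProduct]

theorem mul_companionOf_of_ne {m : ℕ} (N : Matrix (Fin (m + 1)) (Fin (m + 1)) ℂ)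
    (c : Fin (m + 1) → ℂ) (i : Fin (m + 1)) {j : Fin (m + 1)} (hj : j ≠ Fin.last m) :
    (N * companionOf c) i j = N i (j + 1) := by
  simp [Matrix.mul_apply, companionOf, hj]

theorem exists_companion_list_of_leadingColumns {m : ℕ}
    (M : Matrix (Fin (m + 1)) (Fin (m + 1)) ℂ)
    (hM : ∀ k ≤ m + 1, (leadingColumns M k).det ≠ 0) :
    ∃ l : List (Matrix (Fin (m + 1)) (Fin (m + 1)) ℂ),
      l.length = m + 1 ∧ (∀ C ∈ l, IsCompanion (m + 1) C) ∧ M = l.prod := by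
  have key : ∀ k ≤ m + 1, ∃ l : List (Matrix (Fin (m + 1)) (Fin (m + 1)) ℂ),
      l.length = k ∧ (∀ C ∈ l, IsCompanion (m + 1) C) ∧
        (leadingColumns M k).submatrix id (Equiv.addRight (Fin.ofNat (m + 1) k)) = l.prod := by
    intro k
    induction k with
    | zero =>
      intro _
      refine ⟨[], rfl, by simp, ?_⟩
      ext i j
      simp [leadingColumns_zero, Matrix.one_apply]
    | succ k ih =>
      intro hk
      obtain ⟨l, hl, hC, hp⟩ := ih (by omega)
      set σ := Equiv.addRight (Fin.ofNat (m + 1) k) with hσ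
      have hkv : (Fin.ofNat (m + 1) k).val = k := Nat.mod_eq_of_lt hk
      have hsucc : Fin.ofNat (m + 1) (k + 1) = Fin.ofNat (m + 1) k + 1 := by
        ext
        simp [Fin.val_add]
      set d := (leadingColumns M k)⁻¹.mulVec (fun i => M i (Fin.ofNat (m + 1) k)) with hd
      refine ⟨l ++ [companionOf (d ∘ σ)], by simp [hl], ?_, ?_⟩
      · intro C h
        rcases List.mem_append.1 h with h | h
        · exact hC C h
        · rw [List.mem_singleton.1 h]
          exact isCompanion_companionOf _
      · rw [List.prod_append, List.prod_singleton, ← hp]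
        ext i j
        by_cases hj : j = Fin.last m
        · subst hj
          rw [mul_companionOf_last, Matrix.submatrix_mulVec_equiv]
          have h1 : (d ∘ σ) ∘ σ.symm = d := by
            ext x; simp
          rw [h1, hd, Matrix.mulVec_mulVec, Matrix.mul_nonsing_inv _ (hM k (by omega)).isUnit]
          have h2 : Fin.last m + Fin.ofNat (m + 1) (k + 1) = Fin.ofNat (m + 1) k := by
            rw [hsucc, add_comm (Fin.ofNat (m + 1) k), ← add_assoc, Fin.last_add_one, zero_add]
          simp only [Matrix.submatrix_apply, id, Equiv.coe_addRight, h2]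
          simp only [leadingColumns, hkv, Nat.lt_succ_self, if_true, Matrix.one_mulVec,
            Function.comp_apply, id]
        · rw [mul_companionOf_of_ne _ _ _ hj]
          have h2 : j + Fin.ofNat (m + 1) (k + 1) = j + 1 + Fin.ofNat (m + 1) k := by
            rw [hsucc]
            abel
          have h3 : j + 1 + Fin.ofNat (m + 1) k ≠ Fin.ofNat (m + 1) k := by
            intro h
            apply hj
            have h4 : j + 1 = Fin.last m + 1 := by
              rw [Fin.last_add_one]
              simpa using h
            exact add_right_cancel h4
          simp only [Matrix.submatrix_apply, id, Equiv.coe_addRight, h2, hσ]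
          generalize j + 1 + Fin.ofNat (m + 1) k = q at h3
          have h5 : (q : ℕ) ≠ k := fun h => h3 (Fin.ext (h.trans hkv.symm))
          have h6 : (q : ℕ) < k + 1 ↔ (q : ℕ) < k := by omega
          simp [leadingColumns, h6]
  obtain ⟨l, hl, hC, hp⟩ := key (m + 1) le_rfl
  refine ⟨l, hl, hC, ?_⟩
  rw [← hp, leadingColumns_self]
  ext i j
  simp

theorem det_eq_one_of_unitLowerTriangular {n : ℕ} {X : Matrix (Fin n) (Fin n) ℂ}
    (hX : ∀ i j, i < j → X i j = 0) (hX1 : ∀ i, X i i = 1) : X.det = 1 := by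
  rw [Matrix.det_of_isLowerTriangular X (fun i j h => hX i j h)]
  simp [hX1]

theorem det_leadingColumns_of_unitLowerTriangular {n : ℕ} {X : Matrix (Fin n) (Fin n) ℂ}
    (hX : ∀ i j, i < j → X i j = 0) (hX1 : ∀ i, X i i = 1) (k : ℕ) :
    (leadingColumns X k).det = 1 := by
  apply det_eq_one_of_unitLowerTriangular
  · intro i j h
    simp [leadingColumns, hX i j h, h.ne]
  · intro i
    simp [leadingColumns, hX1]

theorem exists_unitLowerTriangular_leadingColumns_mul {n : ℕ} (A : Matrix (Fin n) (Fin n) ℂ)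
    (hA : A.det ≠ 0) :
    ∀ k ≤ n, ∃ X : Matrix (Fin n) (Fin n) ℂ, (∀ i j, i < j → X i j = 0) ∧ (∀ i, X i i = 1) ∧
      ∀ j ≤ k, (leadingColumns (A * X) j).det ≠ 0 := by
  intro k
  induction k with
  | zero =>
    intro _
    refine ⟨1, fun i j h => Matrix.one_apply_ne h.ne, fun i => Matrix.one_apply_eq i, ?_⟩
    intro j hj
    obtain rfl : j = 0 := by omega
    simp [leadingColumns_zero]
  | succ k ih =>
    intro hk
    obtain ⟨X, hX, hX1, hdet⟩ := ih (by omega)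
    obtain ⟨p, rfl⟩ : ∃ p : Fin n, (p : ℕ) = k := ⟨⟨k, hk⟩, rfl⟩
    set N := leadingColumns (A * X) p with hN
    set φ : Fin n → ℂ := N.adjugate p with hφ
    have hφv : ∀ v, (N.updateCol p v).det = φ ⬝ᵥ v := by
      intro v
      rw [← Matrix.cramer_apply, Matrix.cramer_eq_adjugate_mulVec]
      rfl
    have hlow : ∀ j : Fin n, j < p → φ ⬝ᵥ (A * X).col j = 0 := by
      intro j hj
      rw [← hφv]
      refine Matrix.det_zero_of_column_eq hj.ne (fun i => ?_)
      have : (j : ℕ) < p := hj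
      simp [hj.ne, hN, leadingColumns, this]
    obtain ⟨q, hq, hq0⟩ : ∃ q, p ≤ q ∧ φ ⬝ᵥ A.col q ≠ 0 := by
      by_contra! hcon
      have hAX : (A * X).det ≠ 0 := by
        rw [Matrix.det_mul, det_eq_one_of_unitLowerTriangular hX hX1, mul_one]
        exact hA
      have hzero : Matrix.vecMul φ (A * X) = 0 := by
        ext j
        rcases lt_or_ge j p with hj | hj
        · exact hlow j hj
        · rw [← Matrix.vecMul_vecMul]
          change ∑ i, Matrix.vecMul φ A i * X i j = 0
          refine Finset.sum_eq_zero fun i _ => ?_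
          rcases lt_or_ge i j with hi | hi
          · simp [hX i j hi]
          · have : Matrix.vecMul φ A i = 0 := hcon i (hj.trans hi)
            simp [this]
      have hφ0 : φ = 0 := Matrix.eq_zero_of_vecMul_eq_zero hAX hzero
      apply hdet p le_rfl
      have hup : N.updateCol p (Pi.single p 1) = N := by
        ext i j
        by_cases h : j = p
        · subst h
          simp [hN, leadingColumns, Matrix.one_apply, Pi.single_apply]
        · simp [h]
      rw [← hN, ← hup, hφv, hφ0, zero_dotProduct]
    obtain ⟨x, hx1, hx0, hx⟩ : ∃ x : Fin n → ℂ, x p = 1 ∧ (∀ i, i < p → x i = 0) ∧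
        φ ⬝ᵥ A.mulVec x ≠ 0 := by
      by_cases hp : φ ⬝ᵥ A.col p = 0
      · have hpq : p ≠ q := by
          rintro rfl
          exact hq0 hp
        refine ⟨Pi.single p 1 + Pi.single q 1, by simp [hpq], fun i hi => ?_, ?_⟩
        · simp [hi.ne, (hi.trans_le hq).ne]
        · rw [Matrix.mulVec_add, dotProduct_add, Matrix.mulVec_single_one,
            Matrix.mulVec_single_one, hp, zero_add]
          exact hq0
      · refine ⟨Pi.single p 1, by simp, fun i hi => by simp [hi.ne], ?_⟩
        rw [Matrix.mulVec_single_one]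
        exact hp
    have hmul : A * X.updateCol p x = (A * X).updateCol p (A.mulVec x) := by
      ext i j
      by_cases h : j = p
      · subst h
        simp [Matrix.mul_apply, Matrix.mulVec, dotProduct]
      · simp [Matrix.mul_apply, h]
    refine ⟨X.updateCol p x, ?_, ?_, ?_⟩
    · intro i j hij
      rw [Matrix.updateCol_apply]
      split_ifs with h
      · exact hx0 i (h ▸ hij)
      · exact hX i j hij
    · intro i
      rw [Matrix.updateCol_apply]
      split_ifs with h
      · rw [h, hx1]
      · exact hX1 i
    · intro j hj
      rw [hmul]
      rcases Nat.lt_or_ge p j with h | h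
      · obtain rfl : j = p + 1 := by omega
        rw [leadingColumns_updateCol_succ, ← hN, hφv]
        exact hx
      · rw [leadingColumns_updateCol_of_le _ _ _ h]
        exact hdet j h

/-- Every invertible `n×n` complex matrix is a product of `2n` companion
matrices. -/
theorem stmt15 (n : ℕ) (hn : 1 ≤ n) (A : Matrix (Fin n) (Fin n) ℂ) (hA : IsUnit A) :
    ∃ f : Fin (2 * n) → Matrix (Fin n) (Fin n) ℂ,
      (∀ i, IsCompanion n (f i)) ∧ A = (List.ofFn f).prod := by
  obtain ⟨m, rfl⟩ : ∃ m, n = m + 1 := ⟨n - 1, by omega⟩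
  have hdet : A.det ≠ 0 := ((Matrix.isUnit_iff_isUnit_det A).1 hA).ne_zero
  obtain ⟨X, hX, hX1, hAX⟩ := exists_unitLowerTriangular_leadingColumns_mul A hdet _ le_rfl
  have hXdet : X.det = 1 := det_eq_one_of_unitLowerTriangular hX hX1
  have hXu : IsUnit X.det := by simp [hXdet]
  have : Invertible X := Matrix.invertibleOfIsUnitDet X hXu
  have hXtri : X.BlockTriangular OrderDual.toDual := fun i j h => hX i j h
  have hY : ∀ i j, i < j → X⁻¹ i j = 0 := fun i j h =>
    Matrix.blockTriangular_inv_of_blockTriangular hXtri h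
  have hY1 : ∀ i, X⁻¹ i i = 1 := by
    intro i
    have h : (X * X⁻¹) i i = 1 := by rw [Matrix.mul_nonsing_inv _ hXu, Matrix.one_apply_eq]
    rw [Matrix.mul_apply, Finset.sum_eq_single i, hX1, one_mul] at h
    · exact h
    · intro l _ hl
      rcases lt_or_gt_of_ne hl with hl | hl
      · rw [hY l i hl, mul_zero]
      · rw [hX i l hl, zero_mul]
    · simp
  obtain ⟨l₁, hl₁, hC₁, hp₁⟩ := exists_companion_list_of_leadingColumns (A * X) hAX
  obtain ⟨l₂, hl₂, hC₂, hp₂⟩ := exists_companion_list_of_leadingColumns X⁻¹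
    (fun k _ => by simp [det_leadingColumns_of_unitLowerTriangular hY hY1 k])
  have hlen : (l₁ ++ l₂).length = 2 * (m + 1) := by
    rw [List.length_append, hl₁, hl₂]
    ring
  have hprod : A = (l₁ ++ l₂).prod := by
    rw [List.prod_append, ← hp₁, ← hp₂, Matrix.mul_nonsing_inv_cancel_right _ _ hXu]
  have hC : ∀ C ∈ l₁ ++ l₂, IsCompanion (m + 1) C := by
    intro C h
    exact (List.mem_append.1 h).elim (hC₁ C) (hC₂ C)
  generalize l₁ ++ l₂ = l at hlen hprod hC
  rw [← hlen]
  refine ⟨l.get, fun i => hC _ (List.get_mem l i), ?_⟩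
  rw [List.ofFn_get]
  exact hprod
end

section
/- For every n×n complex matrix M there exist companion matrices C₁, …, C₂ₙ and C₂ₙ₊₁, …, C₄ₙ and a diagonal matrix D such that M = C₁⋯C₂ₙ · D · C₂ₙ₊₁⋯C₄ₙ; in particular, every n×n complex matrix is a product of 4n companion matrices and one diagonal matrix. -/
open Matrix Polynomial

theorem isCompanion_inv_mul {n : ℕ} {X Y : Matrix (Fin n) (Fin n) ℂ} (hX : IsUnit X.det)
    (hXY : ∀ i j k : Fin n, (k : ℕ) = j + 1 → Y i j = X i k) : IsCompanion n (X⁻¹ * Y) := by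
  intro i j hj
  have hk : (j : ℕ) + 1 < n := by omega
  have h : (X⁻¹ * Y) i j = (X⁻¹ * X) i ⟨j + 1, hk⟩ := by
    simp only [Matrix.mul_apply]
    exact Finset.sum_congr rfl fun l _ => by rw [hXY l j ⟨j + 1, hk⟩ rfl]
  rw [h, Matrix.nonsing_inv_mul X hX, Matrix.one_apply]
  simp [Fin.ext_iff]

theorem prod_ofFn_inv_mul_succ {n : ℕ} (X : ℕ → Matrix (Fin n) (Fin n) ℂ) (h0 : X 0 = 1)
    (m : ℕ) (hX : ∀ k < m, IsUnit (X k).det) :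
    (List.ofFn fun k : Fin m => (X k)⁻¹ * X (k + 1)).prod = X m := by
  induction m with
  | zero => simp [h0]
  | succ m ih =>
    have := ih fun k hk => hX k (by omega)
    rw [List.ofFn_succ', List.concat_eq_append, List.prod_append]
    simp only [Fin.val_castSucc, Fin.val_last, List.prod_singleton]
    rw [this, Matrix.mul_nonsing_inv_cancel_left _ _ (hX m (by omega))]

/-- The columns `k, …, k + n - 1` of the block row `[B 0 | B 1 | B 2 | …]`. -/
def columnWindow {R : Type*} {n : ℕ} [NeZero n] (B : ℕ → Matrix (Fin n) (Fin n) R) (k : ℕ) :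
    Matrix (Fin n) (Fin n) R :=
  fun i j => B ((k + j) / n) i (Fin.ofNat n (k + j))

/-- If all blocks met by a window are the same matrix, the window permutes its columns. -/
theorem isUnit_det_columnWindow {n : ℕ} [NeZero n] {B : ℕ → Matrix (Fin n) (Fin n) ℂ} {k : ℕ}
    {A : Matrix (Fin n) (Fin n) ℂ} (hA : IsUnit A.det)
    (hB : ∀ j < n, B ((k + j) / n) = A) : IsUnit (columnWindow B k).det := by
  have h : columnWindow B k = A.submatrix id (Equiv.addLeft (Fin.ofNat n k)) := by
    ext i j
    simp only [columnWindow, hB j j.2, Matrix.submatrix_apply, id, Equiv.coe_addLeft]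
    congr 1
    ext
    simp [Fin.val_add]
  rw [h, Matrix.det_permute']
  exact ((Units.isUnit _).map (Int.castRingHom ℂ)).mul hA

/-- The blocks `1`, `1 + t (A - 1)`, `A`, `A`, …. -/
def interpolatingBlocks {R : Type*} [CommRing R] {n : ℕ} (A : Matrix (Fin n) (Fin n) R) (t : R) :
    ℕ → Matrix (Fin n) (Fin n) R
  | 0 => 1
  | 1 => 1 + t • (A - 1)
  | _ + 2 => A

theorem map_columnWindow_interpolatingBlocks {n : ℕ} [NeZero n] (A : Matrix (Fin n) (Fin n) ℂ)
    (t : ℂ) (k : ℕ) :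
    (evalRingHom t).mapMatrix (columnWindow (interpolatingBlocks (A.map C) X) k) =
      columnWindow (interpolatingBlocks A t) k := by
  ext i j
  simp only [columnWindow, RingHom.mapMatrix_apply, Matrix.map_apply]
  rcases (k + (j : ℕ)) / n with _ | _ | m
  · simp [interpolatingBlocks, Matrix.one_apply, apply_ite]
  · simp [interpolatingBlocks, Matrix.one_apply]
    split_ifs <;> simp
  · simp [interpolatingBlocks]

theorem exists_isUnit_det_columnWindow {n : ℕ} [NeZero n] {A : Matrix (Fin n) (Fin n) ℂ}
    (hA : IsUnit A.det) :
    ∃ t : ℂ, ∀ k < 2 * n, IsUnit (columnWindow (interpolatingBlocks A t) k).det := by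
  let p : ℕ → ℂ[X] := fun k => (columnWindow (interpolatingBlocks (A.map C) X) k).det
  have hp (t : ℂ) (k : ℕ) :
      (p k).eval t = (columnWindow (interpolatingBlocks A t) k).det := by
    rw [← map_columnWindow_interpolatingBlocks, ← RingHom.map_det, coe_evalRingHom]
  have hn : 0 < n := Nat.pos_of_neZero n
  have hp0 (k : ℕ) (hk : k < 2 * n) : p k ≠ 0 := by
    suffices h : ∃ t, IsUnit (columnWindow (interpolatingBlocks A t) k).det by
      obtain ⟨t, ht⟩ := h
      intro h
      rw [← hp, h, eval_zero] at ht
      exact not_isUnit_zero ht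
    by_cases hkn : k < n
    · refine ⟨0, isUnit_det_columnWindow (A := 1) (by simp) fun j hj => ?_⟩
      have : (k + j) / n < 2 := (Nat.div_lt_iff_lt_mul hn).2 (by omega)
      rcases h : (k + j) / n with _ | _ | m
      · rfl
      · simp [interpolatingBlocks]
      · omega
    · refine ⟨1, isUnit_det_columnWindow hA fun j hj => ?_⟩
      have : 1 ≤ (k + j) / n := (Nat.le_div_iff_mul_le hn).2 (by omega)
      rcases h : (k + j) / n with _ | _ | m
      · omega
      · simp [interpolatingBlocks]
      · rfl
  have hprod : ∏ k ∈ Finset.range (2 * n), p k ≠ 0 :=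
    Finset.prod_ne_zero_iff.2 fun k hk => hp0 k (Finset.mem_range.1 hk)
  obtain ⟨t, ht⟩ := Polynomial.exists_eval_ne_zero_of_natDegree_lt_card _ hprod
    ((Cardinal.natCast_lt_aleph0).trans_le (Cardinal.aleph0_le_mk ℂ))
  refine ⟨t, fun k hk => ?_⟩
  rw [eval_prod, Finset.prod_ne_zero_iff] at ht
  rw [← hp]
  exact (ht k (Finset.mem_range.2 hk)).isUnit

theorem exists_prod_isCompanion_eq {n : ℕ} [NeZero n] {A : Matrix (Fin n) (Fin n) ℂ}
    (hA : IsUnit A.det) :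
    ∃ f : Fin (2 * n) → Matrix (Fin n) (Fin n) ℂ,
      (∀ i, IsCompanion n (f i)) ∧ (List.ofFn f).prod = A := by
  obtain ⟨t, ht⟩ := exists_isUnit_det_columnWindow hA
  have hn : 0 < n := Nat.pos_of_neZero n
  let W := columnWindow (interpolatingBlocks A t)
  refine ⟨fun k => (W k)⁻¹ * W (k + 1), fun k => isCompanion_inv_mul (ht k k.2) ?_, ?_⟩
  · intro i j l hl
    have h : (k : ℕ) + 1 + j = k + l := by omega
    simp only [W, columnWindow, h]
  · rw [prod_ofFn_inv_mul_succ W _ (2 * n) ht]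
    · ext i j
      have h : (2 * n + (j : ℕ)) / n = 2 := by
        rw [mul_comm, Nat.mul_add_div hn, Nat.div_eq_of_lt j.2]
      have hcol : Fin.ofNat n (2 * n + j) = j := by
        ext; simp [Nat.mod_eq_of_lt j.2]
      simp only [W, columnWindow, h, hcol, interpolatingBlocks]
    · ext i j
      have h : (0 + (j : ℕ)) / n = 0 := by
        rw [zero_add, Nat.div_eq_of_lt j.2]
      have hcol : Fin.ofNat n (0 + j) = j := by
        ext; simp
      simp only [W, columnWindow, h, interpolatingBlocks]
      rw [hcol]

/-- Every `n×n` complex matrix `M` can be written as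
`M = C₁⋯C₂ₙ · D · C₂ₙ₊₁⋯C₄ₙ` with all `Cᵢ` companion matrices and `D` diagonal. -/
theorem stmt16 (n : ℕ) (hn : 1 ≤ n) (M : Matrix (Fin n) (Fin n) ℂ) :
    ∃ f g : Fin (2 * n) → Matrix (Fin n) (Fin n) ℂ, ∃ D : Matrix (Fin n) (Fin n) ℂ,
      (∀ i, IsCompanion n (f i)) ∧ (∀ i, IsCompanion n (g i)) ∧
      (∀ i j : Fin n, i ≠ j → D i j = 0) ∧
      M = (List.ofFn f).prod * D * (List.ofFn g).prod := by
  have : NeZero n := ⟨by omega⟩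
  obtain ⟨L, L', D, hM⟩ := Matrix.Pivot.exists_list_transvec_mul_diagonal_mul_list_transvec M
  obtain ⟨f, hf, hfL⟩ := exists_prod_isCompanion_eq
    (A := (L.map TransvectionStruct.toMatrix).prod) (by simp)
  obtain ⟨g, hg, hgL⟩ := exists_prod_isCompanion_eq
    (A := (L'.map TransvectionStruct.toMatrix).prod) (by simp)
  exact ⟨f, g, diagonal D, hf, hg, fun i j hij => diagonal_apply_ne D hij, by rw [hfL, hgL, hM]⟩
end

section
/- There exists a nonzero polynomial P in the n² matrix entries such that every n×n complex matrix A with P(A) ≠ 0 has a unique decomposition as a product of n companion matrices: A can be written as A = C₁⋯Cₙ with each Cᵢ a companion matrix, and if also A = C′₁⋯C′ₙ with each C′ᵢ a companion matrix, then Cᵢ = C′ᵢ for all i = 1, …, n. -/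
/-- The matrix whose columns are `e_k, …, e_{n-1}` followed by the first `k` columns of `A`
(for `k ≤ n`). -/
def shiftedColumns {n : ℕ} {R : Type*} [Zero R] [One R] (k : ℕ) (A : Matrix (Fin n) (Fin n) R) :
    Matrix (Fin n) (Fin n) R :=
  fun i j => (if (j : ℕ) + k < n then 1 else A) i ⟨(j + k) % n, Nat.mod_lt _ j.pos⟩

section ShiftedColumns

variable {n : ℕ} {R S : Type*}

theorem shiftedColumns_zero [Zero R] [One R] (A : Matrix (Fin n) (Fin n) R) :
    shiftedColumns 0 A = 1 := by
  ext i j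
  have hj : (⟨((j : ℕ) + 0) % n, Nat.mod_lt _ j.pos⟩ : Fin n) = j :=
    Fin.ext (Nat.mod_eq_of_lt j.isLt)
  rw [shiftedColumns, if_pos (by simp), hj]

theorem shiftedColumns_self [Zero R] [One R] (A : Matrix (Fin n) (Fin n) R) :
    shiftedColumns n A = A := by
  ext i j
  have hj : (⟨((j : ℕ) + n) % n, Nat.mod_lt _ j.pos⟩ : Fin n) = j :=
    Fin.ext (by simp [Nat.mod_eq_of_lt j.isLt])
  rw [shiftedColumns, if_neg (by simp), hj]

theorem shiftedColumns_succ_apply [Zero R] [One R] (k : ℕ) (A : Matrix (Fin n) (Fin n) R)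
    (i j : Fin n) (hj : (j : ℕ) + 1 < n) :
    shiftedColumns (k + 1) A i j = shiftedColumns k A i ⟨j + 1, hj⟩ := by
  simp only [shiftedColumns, add_assoc, add_comm 1 k]

theorem shiftedColumns_map [Semiring R] [Semiring S] (φ : R →+* S) (k : ℕ)
    (A : Matrix (Fin n) (Fin n) R) :
    φ.mapMatrix (shiftedColumns k A) = shiftedColumns k (φ.mapMatrix A) := by
  ext i j
  by_cases h : (j : ℕ) + k < n <;> simp [shiftedColumns, h, Matrix.one_apply, apply_ite φ]

theorem det_shiftedColumns_one_ne_zero [CommRing R] [Nontrivial R] (k : ℕ) :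
    (shiftedColumns k (1 : Matrix (Fin n) (Fin n) R)).det ≠ 0 := by
  rcases Nat.eq_zero_or_pos n with rfl | hn
  · simp
  have : NeZero n := ⟨hn.ne'⟩
  have h : shiftedColumns k (1 : Matrix (Fin n) (Fin n) R) =
      (1 : Matrix (Fin n) (Fin n) R).submatrix id (Equiv.addRight (Fin.ofNat n k)) := by
    ext i j
    simp only [shiftedColumns, ite_self, Matrix.submatrix_apply]
    exact congrArg _ (Fin.ext (by simp [Fin.val_add]))
  rw [h, Matrix.det_permute', Matrix.det_one, mul_one]
  exact ((Equiv.Perm.sign _).isUnit.map (Int.castRingHom R)).ne_zero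

end ShiftedColumns

/-- Right multiplication by a companion matrix shifts the columns to the left. -/
theorem IsCompanion.mul_apply {n : ℕ} {C : Matrix (Fin n) (Fin n) ℂ} (hC : IsCompanion n C)
    (M : Matrix (Fin n) (Fin n) ℂ) (i j : Fin n) (hj : (j : ℕ) + 1 < n) :
    (M * C) i j = M i ⟨j + 1, hj⟩ := by
  rw [Matrix.mul_apply, Finset.sum_eq_single ⟨j + 1, hj⟩]
  · rw [hC _ j (by omega)]
    simp
  · intro l _ hl
    rw [hC l j (by omega), if_neg (fun h => hl (Fin.ext h)), mul_zero]
  · simp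

theorem isCompanion_of_mul_apply {n : ℕ} {M C : Matrix (Fin n) (Fin n) ℂ} (hM : M.det ≠ 0)
    (h : ∀ (i j : Fin n) (hj : (j : ℕ) + 1 < n), (M * C) i j = M i ⟨j + 1, hj⟩) :
    IsCompanion n C := by
  intro i j hj
  have hj' : (j : ℕ) + 1 < n := by omega
  have hcol : M.mulVec (fun l => C l j) =
      M.mulVec (fun l => (1 : Matrix (Fin n) (Fin n) ℂ) l ⟨j + 1, hj'⟩) := by
    ext l
    have h1 := h l j hj'
    rw [← Matrix.mul_one M, Matrix.mul_assoc, Matrix.one_mul] at h1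
    exact h1
  have hinj := Matrix.mulVec_injective_of_isUnit
    ((Matrix.isUnit_iff_isUnit_det M).2 (isUnit_iff_ne_zero.2 hM))
  simpa [Matrix.one_apply, Fin.ext_iff] using congrFun (hinj hcol) i

theorem prod_take_ofFn_succ {M : Type*} [Monoid M] {n : ℕ} (f : Fin n → M) (k : ℕ) (hk : k < n) :
    ((List.ofFn f).take (k + 1)).prod = ((List.ofFn f).take k).prod * f ⟨k, hk⟩ := by
  rw [List.prod_take_succ _ _ (by simpa using hk)]
  simp

/-- The partial products of companion matrices are determined by the full product. -/
theorem prod_take_ofFn_eq_shiftedColumns {n : ℕ} {f : Fin n → Matrix (Fin n) (Fin n) ℂ}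
    (hf : ∀ i, IsCompanion n (f i)) (k : ℕ) (hk : k ≤ n) :
    ((List.ofFn f).take k).prod = shiftedColumns k (List.ofFn f).prod := by
  have shift : ∀ d k : ℕ, k + d ≤ n → ∀ (i j : Fin n) (hj : (j : ℕ) + d < n),
      ((List.ofFn f).take (k + d)).prod i j = ((List.ofFn f).take k).prod i ⟨j + d, hj⟩ := by
    intro d
    induction d with
    | zero => simp
    | succ d ih =>
      intro k hk i j hj
      rw [← add_assoc, prod_take_ofFn_succ f (k + d) (by omega),
        (hf _).mul_apply _ i j (by omega), ih k (by omega) i ⟨j + 1, by omega⟩ (by simp; omega)]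
      exact congrArg _ (Fin.ext (by simp only []; omega))
  ext i j
  by_cases h : (j : ℕ) + k < n
  · have := shift k 0 (by omega) i j h
    simp only [zero_add, List.take_zero, List.prod_nil] at this
    simp only [shiftedColumns, h, if_true, this, Nat.mod_eq_of_lt h]
  · have hmod : ((j : ℕ) + k) % n = j + k - n := by
      rw [Nat.mod_eq_sub_mod (by omega), Nat.mod_eq_of_lt (by omega)]
    have := shift (n - k) k (by omega) i ⟨j + k - n, by omega⟩ (by simp only []; omega)
    rw [Nat.add_sub_cancel' hk, List.take_of_length_le (by simp)] at this
    simp only [shiftedColumns, h, if_false, hmod, this]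
    exact congrArg _ (Fin.ext (by simp only []; omega))

/-- There exists a nonzero polynomial `P` in the matrix entries such that
every `n×n` complex matrix `A` with `P(A) ≠ 0` has a unique decomposition as a product of
`n` companion matrices. -/
theorem stmt17 (n : ℕ) (hn : 1 ≤ n) :
    ∃ P : MvPolynomial (Fin n × Fin n) ℂ, P ≠ 0 ∧
      ∀ A : Matrix (Fin n) (Fin n) ℂ,
        MvPolynomial.eval (fun p => A p.1 p.2) P ≠ 0 →
        ∃! f : Fin n → Matrix (Fin n) (Fin n) ℂ,
          (∀ i, IsCompanion n (f i)) ∧ A = (List.ofFn f).prod := by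
  let X : Matrix (Fin n) (Fin n) (MvPolynomial (Fin n × Fin n) ℂ) :=
    Matrix.of fun i j => MvPolynomial.X (i, j)
  let P : MvPolynomial (Fin n × Fin n) ℂ := ∏ k ∈ Finset.range n, (shiftedColumns k X).det
  have eval_P : ∀ A : Matrix (Fin n) (Fin n) ℂ, MvPolynomial.eval (fun p => A p.1 p.2) P =
      ∏ k ∈ Finset.range n, (shiftedColumns k A).det := by
    intro A
    have hX : (MvPolynomial.eval fun p : Fin n × Fin n => A p.1 p.2).mapMatrix X = A := by
      ext i j
      simp [X]
    simp only [P, map_prod, RingHom.map_det, shiftedColumns_map, hX]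
  refine ⟨P, fun hP => ?_, fun A hA => ?_⟩
  · have h1 := eval_P 1
    rw [hP, map_zero] at h1
    exact Finset.prod_ne_zero_iff.2 (fun k _ => det_shiftedColumns_one_ne_zero k) h1.symm
  · rw [eval_P, Finset.prod_ne_zero_iff] at hA
    have hdet : ∀ k : Fin n, IsUnit (shiftedColumns k A).det := fun k =>
      isUnit_iff_ne_zero.2 (hA k (Finset.mem_range.2 k.isLt))
    let f : Fin n → Matrix (Fin n) (Fin n) ℂ :=
      fun k => (shiftedColumns k A)⁻¹ * shiftedColumns (k + 1) A
    have mul_f : ∀ k : Fin n, shiftedColumns k A * f k = shiftedColumns (k + 1) A := fun k =>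
      Matrix.mul_nonsing_inv_cancel_left _ _ (hdet k)
    refine ⟨f, ⟨fun k => ?_, ?_⟩, ?_⟩
    · refine isCompanion_of_mul_apply (hdet k).ne_zero fun i j hj => ?_
      rw [mul_f, shiftedColumns_succ_apply]
    · have prod_take_f : ∀ k ≤ n, ((List.ofFn f).take k).prod = shiftedColumns k A := by
        intro k
        induction k with
        | zero => simp [shiftedColumns_zero]
        | succ k ih =>
          intro hk
          rw [prod_take_ofFn_succ f k hk, ih (by omega)]
          exact mul_f ⟨k, hk⟩
      have h := prod_take_f n le_rfl
      rw [List.take_of_length_le (by simp), shiftedColumns_self] at h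
      exact h.symm
    · rintro g ⟨hg, hgA⟩
      ext1 k
      have h := prod_take_ofFn_succ g k k.isLt
      rw [prod_take_ofFn_eq_shiftedColumns hg _ k.isLt,
        prod_take_ofFn_eq_shiftedColumns hg _ k.isLt.le, ← hgA] at h
      simp only [f, h]
      exact (Matrix.nonsing_inv_mul_cancel_left _ _ (hdet k)).symm
end

section
/- Let n ≥ 2 and let A be an n×n complex matrix with A 0 0 = 0 and A 0 1 = 1 (the (1,1) entry is 0 and the (1,2) entry is 1, in 1-indexed notation). Then A is not a product of n companion matrices. -/
/-- A product of fewer than `n` companion matrices sends the first standard basis vector `e_0`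
to `e_k`, where `k` is the number of factors. -/
lemma IsCompanion.list_prod_apply_zero {n : ℕ} (hn : 0 < n)
    (L : List (Matrix (Fin n) (Fin n) ℂ)) (hL : ∀ C ∈ L, IsCompanion n C)
    (hlen : L.length < n) (i : Fin n) :
    L.prod i ⟨0, hn⟩ = if i = ⟨L.length, hlen⟩ then 1 else 0 := by
  induction L generalizing i with
  | nil => simp [Matrix.one_apply]
  | cons C L ih =>
    rw [List.length_cons] at hlen
    have hL' : ∀ D ∈ L, IsCompanion n D := fun D hD => hL D (List.mem_cons_of_mem _ hD)
    simp only [List.prod_cons, Matrix.mul_apply, ih hL' (by omega), mul_ite, mul_one, mul_zero,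
      Finset.sum_ite_eq', Finset.mem_univ, if_true]
    simpa [Fin.ext_iff] using hL C List.mem_cons_self i ⟨L.length, by omega⟩ (by simp only; omega)

/-- Only the last entry of the first row of a companion matrix can be nonzero. -/
lemma IsCompanion.apply_zero_of_ne_last {m : ℕ} {C : Matrix (Fin (m + 1)) (Fin (m + 1)) ℂ}
    (hC : IsCompanion (m + 1) C) {j : Fin (m + 1)} (hj : j ≠ Fin.last m) : C 0 j = 0 := by
  have hlt : (j : ℕ) < m := Fin.val_lt_last hj
  simpa using hC 0 j (by simpa using hlt)

/-- If `n ≥ 2` and `A` is an `n×n` complex matrix with `A 0 0 = 0` and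
`A 0 1 = 1`, then `A` is not a product of `n` companion matrices. -/
theorem stmt18 (n : ℕ) (hn : 2 ≤ n) (A : Matrix (Fin n) (Fin n) ℂ)
    (h00 : A ⟨0, by omega⟩ ⟨0, by omega⟩ = 0)
    (h01 : A ⟨0, by omega⟩ ⟨1, by omega⟩ = 1) :
    ¬ ∃ f : Fin n → Matrix (Fin n) (Fin n) ℂ,
        (∀ i, IsCompanion n (f i)) ∧ A = (List.ofFn f).prod := by
  rintro ⟨f, hf, rfl⟩
  obtain ⟨m, rfl⟩ : ∃ m, n = m + 1 := ⟨n - 1, by omega⟩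
  rw [List.ofFn_succ, List.prod_cons] at h00 h01
  set L := List.ofFn fun i : Fin m => f i.succ with hL
  have hrow (j : Fin (m + 1)) :
      (f 0 * L.prod) 0 j = f 0 0 (Fin.last m) * L.prod (Fin.last m) j := by
    rw [Matrix.mul_apply]
    refine Finset.sum_eq_single _ (fun k _ hk => ?_) (by simp)
    rw [(hf 0).apply_zero_of_ne_last hk, zero_mul]
  have hlen : L.length = m := by simp [hL]
  have hlast : L.prod (Fin.last m) 0 = 1 := by
    have h := IsCompanion.list_prod_apply_zero m.succ_pos L
      (by simpa [hL, List.mem_ofFn] using fun i : Fin m => hf i.succ) (by omega) (Fin.last m)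
    simpa [hlen, Fin.ext_iff] using h
  have h0 : f 0 0 (Fin.last m) = 0 := by
    simpa [hlast] using (hrow 0).symm.trans h00
  have hzero := (hrow _).symm.trans h01
  simp [h0] at hzero
end

section
/- Let s₁, …, sₙ be integers such that sᵢ ≢ sⱼ (mod n) for i ≠ j and s₁ + ⋯ + sₙ ≠ 0. Then every invertible n×n complex matrix M can be written as M = B₁A₁⋯BₙAₙ·B′₁A′₁⋯B′ₙA′ₙ, where for each i the matrices Aᵢ and A′ᵢ are generalized Vandermonde matrices of type sᵢ and the matrices Bᵢ and B′ᵢ are transposes of generalized Vandermonde matrices of type sᵢ. -/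
/-- An `n×n` matrix is a generalized Vandermonde matrix of type `s`: there exist nonzero
complex numbers `x₀, …, x_{n-1}` with `M p q = x_q ^ (s + p)` (integer power). -/
def IsGenVandermonde (n : ℕ) (s : ℤ) (M : Matrix (Fin n) (Fin n) ℂ) : Prop :=
  ∃ x : Fin n → ℂ, (∀ q, x q ≠ 0) ∧ ∀ p q : Fin n, M p q = x q ^ (s + (p : ℕ))

open Topology

/-- A dominant map of complex varieties is surjective on points over a nonempty principal open
subset of its target. -/
theorem exists_ne_zero_forall_exists_algHom {A B : Type*} [CommRing A] [IsDomain A]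
    [IsNoetherianRing A] [CommRing B] [Algebra ℂ A] [Algebra ℂ B] [Algebra.FiniteType ℂ B]
    (f : A →ₐ[ℂ] B) (hf : Function.Injective f) :
    ∃ g : A, g ≠ 0 ∧ ∀ φ : A →ₐ[ℂ] ℂ, φ g ≠ 0 → ∃ ψ : B →ₐ[ℂ] ℂ, ψ.comp f = φ := by
  have hft : f.toRingHom.FiniteType := by
    refine RingHom.FiniteType.of_comp_finiteType (f := algebraMap ℂ A) (g := f.toRingHom) ?_
    have : f.toRingHom.comp (algebraMap ℂ A) = algebraMap ℂ B := f.comp_algebraMap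
    rw [this]
    exact RingHom.finiteType_algebraMap.mpr inferInstance
  obtain ⟨S, hS⟩ := PrimeSpectrum.exists_constructibleSetData_iff.mpr
    (PrimeSpectrum.isConstructible_range_comap (RingHom.FinitePresentation.of_finiteType.mp hft))
  obtain ⟨Q₀, hQ₀, hQ₀'⟩ := Ideal.exists_comap_eq_of_mem_minimalPrimes_of_injective
    (f := f.toRingHom) hf (⊥ : Ideal A) (by simp [IsDomain.minimalPrimes_eq_singleton_bot])
  have hbot : (⊥ : PrimeSpectrum A) ∈ S.toSet := by
    rw [hS]
    exact ⟨⟨Q₀, hQ₀⟩, PrimeSpectrum.ext hQ₀'⟩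
  simp only [PrimeSpectrum.ConstructibleSetData.toSet, Set.mem_iUnion] at hbot
  obtain ⟨C, hCS, hC⟩ := hbot
  have hC1 := hC.1
  have hC2 := hC.2
  rw [PrimeSpectrum.mem_zeroLocus] at hC1 hC2
  refine ⟨C.f, fun h => hC2 (by simp [h]), fun φ hφ => ?_⟩
  have hker : (RingHom.ker φ).IsPrime := RingHom.ker_isPrime φ
  have hmem : (⟨RingHom.ker φ, hker⟩ : PrimeSpectrum A) ∈ S.toSet := by
    simp only [PrimeSpectrum.ConstructibleSetData.toSet, Set.mem_iUnion]
    refine ⟨C, hCS, ?_, ?_⟩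
    · rw [PrimeSpectrum.mem_zeroLocus]
      intro a ha
      have : a = 0 := by simpa using hC1 ha
      simp [this]
    · rw [PrimeSpectrum.mem_zeroLocus]
      simpa using hφ
  rw [hS] at hmem
  obtain ⟨Q, hQ⟩ := hmem
  have hQ' : Q.asIdeal.comap f.toRingHom = RingHom.ker φ := congrArg PrimeSpectrum.asIdeal hQ
  obtain ⟨m, hm, hQm⟩ := Ideal.exists_le_maximal Q.asIdeal Q.isPrime.ne_top
  let _ : Field (B ⧸ m) := Ideal.Quotient.field m
  have : Module.Finite ℂ (B ⧸ m) := finite_of_finite_type_of_isJacobsonRing _ _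
  let e : ℂ ≃ₐ[ℂ] (B ⧸ m) := AlgEquiv.ofBijective (Algebra.ofId ℂ _)
    IsAlgClosed.algebraMap_bijective_of_isIntegral
  refine ⟨(e.symm : (B ⧸ m) →ₐ[ℂ] ℂ).comp (Ideal.Quotient.mkₐ ℂ m), ?_⟩
  ext a
  have h1 : a - algebraMap ℂ A (φ a) ∈ Q.asIdeal.comap f.toRingHom := by
    rw [hQ']
    simp [RingHom.mem_ker]
  have h2 : f a - algebraMap ℂ B (φ a) ∈ m := by
    apply hQm
    simpa using h1
  have h3 : Ideal.Quotient.mkₐ ℂ m (f a) = algebraMap ℂ (B ⧸ m) (φ a) := by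
    have := Ideal.Quotient.eq_zero_iff_mem.mpr h2
    rw [map_sub, sub_eq_zero] at this
    exact this
  exact (e.symm_apply_eq).mpr h3

/-- A complex polynomial vanishing on a nonempty open set is zero. -/
theorem MvPolynomial.eq_zero_of_eventually_eval_eq_zero {σ : Type*} [Finite σ]
    {g : MvPolynomial σ ℂ} {y₀ : σ → ℂ} (h : ∀ᶠ y in 𝓝 y₀, MvPolynomial.eval y g = 0) :
    g = 0 := by
  rw [Filter.Eventually, nhds_pi, Filter.mem_pi] at h
  obtain ⟨I, -, t, ht, hsub⟩ := h
  refine MvPolynomial.funext_set t (fun i => infinite_of_mem_nhds (y₀ i) (ht i)) fun y hy => ?_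
  rw [map_zero]
  exact hsub fun i _ => hy i trivial

theorem exists_polynomial_of_eventually_exists_algHom {σ B : Type*} [Finite σ] [CommRing B]
    [Algebra ℂ B] [Algebra.FiniteType ℂ B] (F : σ → B) (y₀ : σ → ℂ)
    (h : ∀ᶠ y in 𝓝 y₀, ∃ ψ : B →ₐ[ℂ] ℂ, ∀ i, ψ (F i) = y i) :
    ∃ g : MvPolynomial σ ℂ, g ≠ 0 ∧
      ∀ y, MvPolynomial.eval y g ≠ 0 → ∃ ψ : B →ₐ[ℂ] ℂ, ∀ i, ψ (F i) = y i := by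
  obtain ⟨g, hg, H⟩ := exists_ne_zero_forall_exists_algHom (MvPolynomial.aeval (R := ℂ) F) (by
    rw [injective_iff_map_eq_zero]
    intro p hp
    refine MvPolynomial.eq_zero_of_eventually_eval_eq_zero (y₀ := y₀) (h.mono ?_)
    rintro y ⟨ψ, hψ⟩
    have h0 : ψ (MvPolynomial.aeval F p) = 0 := by rw [hp, map_zero]
    rw [← AlgHom.comp_apply, MvPolynomial.comp_aeval] at h0
    simp only [hψ] at h0
    rw [← h0, MvPolynomial.aeval_eq_eval])
  refine ⟨g, hg, fun y hy => ?_⟩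
  obtain ⟨ψ, hψ⟩ := H (MvPolynomial.aeval y) (by rwa [MvPolynomial.aeval_eq_eval])
  exact ⟨ψ, fun i => by simpa using DFunLike.congr_fun hψ (MvPolynomial.X i)⟩

/-- A finitely generated complex algebra with units whose values at complex points can be
prescribed freely. -/
theorem exists_finiteType_algebra_units (ι : Type) [Finite ι] :
    ∃ (B : Type) (_ : CommRing B) (_ : Algebra ℂ B), Algebra.FiniteType ℂ B ∧
      ∃ u : ι → Bˣ, ∀ x : ι → ℂˣ, ∃ ψ : B →ₐ[ℂ] ℂ, ∀ i, ψ (u i) = x i := by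
  let I : Ideal (MvPolynomial (ι ⊕ ι) ℂ) := Ideal.span (Set.range fun i : ι =>
    MvPolynomial.X (Sum.inl i) * MvPolynomial.X (Sum.inr i) - 1)
  have hI (i : ι) : (Ideal.Quotient.mk I (MvPolynomial.X (Sum.inl i))) *
      Ideal.Quotient.mk I (MvPolynomial.X (Sum.inr i)) = 1 := by
    rw [← map_mul, ← map_one (Ideal.Quotient.mk I), Ideal.Quotient.eq]
    exact Ideal.subset_span ⟨i, rfl⟩
  refine ⟨MvPolynomial (ι ⊕ ι) ℂ ⧸ I, inferInstance, inferInstance, inferInstance,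
    fun i => ⟨Ideal.Quotient.mk I (MvPolynomial.X (Sum.inl i)),
      Ideal.Quotient.mk I (MvPolynomial.X (Sum.inr i)), hI i, by rw [mul_comm, hI i]⟩,
    fun x => ⟨Ideal.Quotient.liftₐ I (MvPolynomial.aeval
      (Sum.elim (fun i => (x i : ℂ)) fun i => (((x i)⁻¹ : ℂˣ) : ℂ))) ?_, fun i => ?_⟩⟩
  · intro a ha
    have : I ≤ RingHom.ker (MvPolynomial.aeval (R := ℂ)
        (Sum.elim (fun i => (x i : ℂ)) fun i => (((x i)⁻¹ : ℂˣ) : ℂ))) := by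
      rw [Ideal.span_le]
      rintro _ ⟨i, rfl⟩
      simp [RingHom.mem_ker]
    exact this ha
  · simp [Ideal.Quotient.liftₐ_apply]

/-- If a set of matrices contains the complement of a hypersurface, then every invertible matrix
is a product of two of its elements. -/
theorem exists_mul_eq_of_polynomial {n : ℕ} {U : Set (Matrix (Fin n) (Fin n) ℂ)}
    {g : MvPolynomial (Fin n × Fin n) ℂ} (hg : g ≠ 0)
    (hU : ∀ X : Matrix (Fin n) (Fin n) ℂ, MvPolynomial.eval (fun p => X p.1 p.2) g ≠ 0 → X ∈ U)
    {M : Matrix (Fin n) (Fin n) ℂ} (hM : IsUnit M) :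
    ∃ X ∈ U, ∃ Y ∈ U, M = X * Y := by
  obtain ⟨d, hd, hdet⟩ : ∃ d : MvPolynomial (Fin n × Fin n) ℂ, d ≠ 0 ∧
      ∀ X : Matrix (Fin n) (Fin n) ℂ, MvPolynomial.eval (fun p => X p.1 p.2) d = X.det := by
    refine ⟨Matrix.det (Matrix.mvPolynomialX (Fin n) (Fin n) ℂ),
      Matrix.det_mvPolynomialX_ne_zero _ _, fun X => ?_⟩
    rw [RingHom.map_det]
    congr 1
    ext a b
    simp
  have hev (X : Matrix (Fin n) (Fin n) ℂ) {p : MvPolynomial (Fin n × Fin n) ℂ} (hp : p ≠ 0)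
      {s : Set (Matrix (Fin n) (Fin n) ℂ)} (hs : s ∈ 𝓝 X) :
      ∃ Y ∈ s, MvPolynomial.eval (fun p => Y p.1 p.2) p ≠ 0 := by
    by_contra! hcon
    refine hp (MvPolynomial.eq_zero_of_eventually_eval_eq_zero (y₀ := fun p => X p.1 p.2) ?_)
    have hc : Continuous fun y : Fin n × Fin n → ℂ =>
        (Matrix.of fun a b => y (a, b) : Matrix (Fin n) (Fin n) ℂ) :=
      continuous_matrix fun a b => continuous_apply _
    have : ∀ᶠ y in 𝓝 (fun p : Fin n × Fin n => X p.1 p.2),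
      (Matrix.of fun a b => y (a, b)) ∈ s := hc.continuousAt.preimage_mem_nhds hs
    exact this.mono fun y hy => by simpa using hcon (Matrix.of fun a b => y (a, b)) hy
  have hgd : g * d ≠ 0 := mul_ne_zero hg hd
  obtain ⟨V, -, hV⟩ := hev 1 hgd (s := Set.univ) Filter.univ_mem
  rw [map_mul, hdet] at hV
  have hVu : IsUnit V.det := (right_ne_zero_of_mul hV).isUnit
  have hMu : IsUnit M.det := (Matrix.isUnit_iff_isUnit_det M).mp hM
  let ev : Matrix (Fin n) (Fin n) ℂ → ℂ := fun X =>
    MvPolynomial.eval (fun p => (X.det⁻¹ • X.adjugate * M) p.1 p.2) g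
  have hX₀ : (M * V⁻¹).det ≠ 0 := by
    rw [Matrix.det_mul, Matrix.det_nonsing_inv, Ring.inverse_eq_inv']
    exact mul_ne_zero hMu.ne_zero (inv_ne_zero hVu.ne_zero)
  have hev₀ : ev (M * V⁻¹) ≠ 0 := by
    have : (M * V⁻¹).det⁻¹ • (M * V⁻¹).adjugate * M = V := by
      rw [← Ring.inverse_eq_inv', ← Matrix.inv_def, Matrix.mul_inv_rev,
        Matrix.nonsing_inv_nonsing_inv _ hVu, Matrix.mul_assoc, Matrix.nonsing_inv_mul _ hMu,
        Matrix.mul_one]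
    simp only [ev, this]
    exact left_ne_zero_of_mul hV
  have hcont : ContinuousAt ev (M * V⁻¹) := by
    have h1 : ContinuousAt (fun X : Matrix (Fin n) (Fin n) ℂ => X.det⁻¹ • X.adjugate * M)
        (M * V⁻¹) :=
      ((((continuous_id.matrix_det).continuousAt).inv₀ hX₀).smul
        (continuous_id.matrix_adjugate).continuousAt).mul continuousAt_const
    have h2 : Continuous fun X : Matrix (Fin n) (Fin n) ℂ =>
        MvPolynomial.eval (fun p => X p.1 p.2) g :=
      (MvPolynomial.continuous_eval g).comp (by fun_prop)
    exact h2.continuousAt.comp h1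
  obtain ⟨X, ⟨hX1, hX2⟩, hX3⟩ := hev (M * V⁻¹) hg (Filter.inter_mem
    ((continuous_id.matrix_det).continuousAt.eventually_ne hX₀) (hcont.eventually_ne hev₀))
  have hXu : IsUnit X.det := IsUnit.mk0 _ hX1
  refine ⟨X, hU X hX3, _, hU _ hX2, ?_⟩
  rw [← Ring.inverse_eq_inv', ← Matrix.inv_def, ← Matrix.mul_assoc,
    Matrix.mul_nonsing_inv _ hXu, Matrix.one_mul]

/-- The Fourier-type sum of `t * ζ ^ (k * t)` over `s ≤ t < s + n`, where
`ζ = exp (2 * π * I / n)`. -/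
noncomputable def weightedCharSum (n : ℕ) [NeZero n] (s : ℤ) (k : ZMod n) : ℂ :=
  ∑ p : Fin n, ((s + (p : ℕ) : ℤ) : ℂ) * ZMod.stdAddChar (k * ((s + (p : ℕ) : ℤ) : ZMod n))

section WeightedCharSum

variable {n : ℕ} [NeZero n]

theorem sum_stdAddChar_mul {k : ZMod n} (hk : k ≠ 0) :
    ∑ a : ZMod n, ZMod.stdAddChar (k * a) = 0 := by
  have := AddChar.sum_mulShift k (ZMod.isPrimitive_stdAddChar n)
  simpa [hk, mul_comm] using this

theorem bijective_intCast_of_incongruent {s : Fin n → ℤ}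
    (hs : ∀ i j : Fin n, i ≠ j → ¬ ((n : ℤ) ∣ (s i - s j))) :
    Function.Bijective fun i => (s i : ZMod n) := by
  refine (Fintype.bijective_iff_injective_and_card _).mpr ⟨fun i j hij => ?_, by simp [ZMod.card]⟩
  by_contra hne
  refine hs j i (Ne.symm hne) ?_
  exact (ZMod.intCast_eq_intCast_iff_dvd_sub _ _ _).mp hij

theorem bijective_intCast_add (s : ℤ) :
    Function.Bijective fun p : Fin n => ((s + (p : ℕ) : ℤ) : ZMod n) := by
  refine bijective_intCast_of_incongruent fun i j hij h => hij (Fin.ext ?_)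
  have h1 : (s + (i : ℕ) - (s + (j : ℕ)) : ℤ) = (i : ℕ) - (j : ℕ) := by ring
  rw [h1] at h
  have := Int.eq_zero_of_abs_lt_dvd h (by rw [abs_lt]; omega)
  omega

theorem weightedCharSum_zero (s : ℤ) :
    weightedCharSum n s 0 = n * (s + ((n : ℂ) - 1) / 2) := by
  have h : ∀ m : ℕ, ∑ p ∈ Finset.range m, ((s : ℂ) + p) = m * (s + ((m : ℂ) - 1) / 2) := by
    intro m
    induction m with
    | zero => simp
    | succ m ih => rw [Finset.sum_range_succ, ih]; push_cast; ring
  simp [weightedCharSum, ← h, Finset.sum_range]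

theorem weightedCharSum_mul_sub_one (s : ℤ) {k : ZMod n} (hk : k ≠ 0) :
    weightedCharSum n s k * (ZMod.stdAddChar k - 1) = n * ZMod.stdAddChar (k * (s : ZMod n)) := by
  have h1 : ∑ p : Fin n, ZMod.stdAddChar (k * ((s + 1 + (p : ℕ) : ℤ) : ZMod n)) = 0 := by
    rw [← sum_stdAddChar_mul hk]
    exact (bijective_intCast_add (s + 1)).sum_comp fun a => ZMod.stdAddChar (k * a)
  let f : ℕ → ℂ := fun p => ((s + p : ℤ) : ℂ) * ZMod.stdAddChar (k * ((s + p : ℤ) : ZMod n))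
  have h2 := Finset.sum_range_sub f n
  rw [Finset.sum_range] at h2
  have h3 : weightedCharSum n s k * (ZMod.stdAddChar k - 1) =
      ∑ p : Fin n, (f (p + 1) - f p) -
        ∑ p : Fin n, ZMod.stdAddChar (k * ((s + 1 + (p : ℕ) : ℤ) : ZMod n)) := by
    rw [weightedCharSum, Finset.sum_mul, ← Finset.sum_sub_distrib]
    refine Finset.sum_congr rfl fun p _ => ?_
    have h4 : k * ((s + 1 + (p : ℕ) : ℤ) : ZMod n) = k * ((s + (p : ℕ) : ℤ) : ZMod n) + k := by
      push_cast; ring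
    have h5 : k * ((s + (p + 1 : ℕ) : ℤ) : ZMod n) = k * ((s + (p : ℕ) : ℤ) : ZMod n) + k := by
      push_cast; ring
    simp only [f]
    rw [h4, h5, AddChar.map_add_eq_mul]
    push_cast
    ring
  rw [h3, h1, h2]
  simp only [f]
  push_cast
  simp
  ring

theorem stdAddChar_sub_one_ne_zero {k : ZMod n} (hk : k ≠ 0) :
    ZMod.stdAddChar k - (1 : ℂ) ≠ 0 := by
  rw [sub_ne_zero, ← AddChar.map_zero_eq_one (ZMod.stdAddChar (N := n))]
  exact fun h => hk (ZMod.injective_stdAddChar h)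

theorem weightedCharSum_eq_div (s : ℤ) {k : ZMod n} (hk : k ≠ 0) :
    weightedCharSum n s k = n * ZMod.stdAddChar (k * (s : ZMod n)) / (ZMod.stdAddChar k - 1) := by
  rw [eq_div_iff (stdAddChar_sub_one_ne_zero hk), weightedCharSum_mul_sub_one s hk]

variable {s : Fin n → ℤ} (hs : ∀ i j : Fin n, i ≠ j → ¬ ((n : ℤ) ∣ (s i - s j)))
include hs

theorem sum_weightedCharSum_of_ne_zero {k : ZMod n} (hk : k ≠ 0) :
    ∑ i, weightedCharSum n (s i) k = 0 := by
  simp only [weightedCharSum_eq_div _ hk]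
  rw [← Finset.sum_div, ← Finset.mul_sum,
    (bijective_intCast_of_incongruent hs).sum_comp fun a => ZMod.stdAddChar (k * a),
    sum_stdAddChar_mul hk, mul_zero, zero_div]

omit hs in
theorem sum_weightedCharSum_zero :
    ∑ i, weightedCharSum n (s i) 0 = n * (∑ i, (s i : ℂ) + n * ((n : ℂ) - 1) / 2) := by
  simp only [weightedCharSum_zero, ← Finset.mul_sum, Finset.sum_add_distrib, Finset.sum_const,
    Finset.card_univ, Fintype.card_fin, nsmul_eq_mul]
  ring

theorem eq_zero_of_sum_weightedCharSum_mul {u : ZMod n → ℂ} (hu0 : u 0 = 0)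
    (hu : ∀ i, ∑ k, weightedCharSum n (s i) k * u k = 0) : u = 0 := by
  let m : ZMod n → ℂ := fun k => u k * (n / (ZMod.stdAddChar k - 1))
  have hm (a : ZMod n) : ∑ k, ZMod.stdAddChar (k * a) • m k = 0 := by
    obtain ⟨i, rfl⟩ := (bijective_intCast_of_incongruent hs).2 a
    rw [← hu i]
    refine Finset.sum_congr rfl fun k _ => ?_
    rcases eq_or_ne k 0 with rfl | hk
    · simp [m, hu0]
    · rw [weightedCharSum_eq_div _ hk, smul_eq_mul]
      simp only [m]
      ring
  have hm0 : m = 0 := by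
    apply (ZMod.dft (N := n) (E := ℂ)).symm.injective
    ext a
    rw [ZMod.invDFT_apply, hm, map_zero, smul_zero, Pi.zero_apply]
  ext k
  rcases eq_or_ne k 0 with rfl | hk
  · exact hu0
  · have := congrFun hm0 k
    simp only [m, Pi.zero_apply, mul_eq_zero, div_eq_zero_iff] at this
    simpa [stdAddChar_sub_one_ne_zero hk, NeZero.ne n] using this

theorem eq_zero_of_sum_weightedCharSum_mul_of_sum_ne_zero {u : ZMod n → ℂ}
    (hsum : ∑ i, (s i : ℂ) + n * ((n : ℂ) - 1) / 2 ≠ 0)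
    (hu : ∀ i, ∑ k, weightedCharSum n (s i) k * u k = 0) : u = 0 := by
  refine eq_zero_of_sum_weightedCharSum_mul hs ?_ hu
  have h : ∑ i, ∑ k, weightedCharSum n (s i) k * u k = 0 := Finset.sum_eq_zero fun i _ => hu i
  rw [Finset.sum_comm] at h
  simp only [← Finset.sum_mul] at h
  rw [Finset.sum_eq_single 0 (fun k _ hk => by rw [sum_weightedCharSum_of_ne_zero hs hk, zero_mul])
    (by simp), sum_weightedCharSum_zero] at h
  simpa [hsum, NeZero.ne n] using h

theorem eq_zero_of_row_column_relations (hn : 2 ≤ n) {Y : ZMod n → ZMod n → ℂ}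
    (hcol : ∀ i b, ∑ a, weightedCharSum n (s i) (b - a) * Y a b = 0)
    (hrow : ∀ i a, ∑ b, weightedCharSum n (s i) (b - a) * Y a b = 0)
    (hY : ∀ a, a ≠ 0 → Y a 0 = 0) : Y = 0 := by
  have hcol' (i : Fin n) (b : ZMod n) : ∑ k, weightedCharSum n (s i) k * Y (b - k) b = 0 := by
    rw [← hcol i b, ← Equiv.sum_comp (Equiv.subLeft b)]
    simp
  have hrow' (i : Fin n) (a : ZMod n) : ∑ k, weightedCharSum n (s i) k * Y a (a + k) = 0 := by
    have := Equiv.sum_comp (Equiv.addLeft a) fun b => weightedCharSum n (s i) (b - a) * Y a b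
    simpa [hrow] using this
  have hcc (b c k : ZMod n) : Y c c * Y (b - k) b = Y b b * Y (c - k) c := by
    have := eq_zero_of_sum_weightedCharSum_mul hs
      (u := fun k => Y c c * Y (b - k) b - Y b b * Y (c - k) c) (by simp; ring) (fun i => by
        simp only [mul_sub, mul_left_comm (weightedCharSum n (s i) _), Finset.sum_sub_distrib,
          ← Finset.mul_sum, hcol', mul_zero, sub_zero])
    exact sub_eq_zero.mp (congrFun this k)
  have hcr (b c k : ZMod n) : Y c c * Y (b - k) b = Y b b * Y c (c + k) := by
    have := eq_zero_of_sum_weightedCharSum_mul hs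
      (u := fun k => Y c c * Y (b - k) b - Y b b * Y c (c + k)) (by simp; ring) (fun i => by
        simp only [mul_sub, mul_left_comm (weightedCharSum n (s i) _), Finset.sum_sub_distrib,
          ← Finset.mul_sum, hcol', hrow', mul_zero, sub_zero])
    exact sub_eq_zero.mp (congrFun this k)
  have hn0 : (n : ℂ) ≠ 0 := NeZero.ne _
  have h00 : Y 0 0 = 0 := by
    by_contra h
    have h1 (i : Fin n) : (s i : ℂ) + ((n : ℂ) - 1) / 2 = 0 := by
      have := hcol' i 0
      rw [Finset.sum_eq_single 0 (fun k _ hk => by rw [zero_sub, hY _ (neg_ne_zero.mpr hk),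
        mul_zero]) (by simp), sub_zero, weightedCharSum_zero] at this
      simpa [h, hn0] using this
    let i : Fin n := ⟨0, by omega⟩
    let j : Fin n := ⟨1, by omega⟩
    have hij : s i = s j := by
      have : (s i : ℂ) = s j := by linear_combination h1 i - h1 j
      exact_mod_cast this
    exact hs i j (by simp [i, j]) (by simp [hij])
  have hdiag (r : ZMod n) : Y r r = 0 := by
    by_contra hr
    have hper (b k : ZMod n) (hk : Y (r - k) r ≠ 0) : Y (b - k) (b - k) = Y b b := by
      have h1 := hcc b r k
      have h2 := hcr r (b - k) k
      rw [sub_add_cancel] at h2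
      exact mul_right_cancel₀ hk (h2.trans h1)
    have hdft (m : ZMod n) (hm : m ≠ 0) : ZMod.dft (fun b => Y b b) m = 0 := by
      by_contra hne
      have hchar (k : ZMod n) (hk : Y (r - k) r ≠ 0) : ZMod.stdAddChar (-(k * m)) = (1 : ℂ) := by
        have h1 : ZMod.dft (fun b => Y b b) m =
            ZMod.stdAddChar (-(k * m)) * ZMod.dft (fun b => Y b b) m := by
          rw [ZMod.dft_apply, Finset.mul_sum, ← Equiv.sum_comp (Equiv.addRight k)]
          refine Finset.sum_congr rfl fun b _ => ?_
          have h2 := hper (b + k) k hk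
          rw [add_sub_cancel_right] at h2
          rw [Equiv.coe_addRight, ← h2, smul_eq_mul, smul_eq_mul, ← mul_assoc,
            ← AddChar.map_add_eq_mul]
          congr 2
          ring
        exact mul_right_cancel₀ hne (by rw [← h1, one_mul])
      let i : Fin n := ⟨0, by omega⟩
      obtain ⟨j, hj⟩ := (bijective_intCast_of_incongruent hs).2 ((s i : ZMod n) - m)
      have hj' : (s j : ZMod n) = s i - m := hj
      have h3 : ∑ k, (weightedCharSum n (s j) k - weightedCharSum n (s i) k) * Y (r - k) r = 0 := by
        simp only [sub_mul, Finset.sum_sub_distrib, hcol', sub_zero]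
      rw [Finset.sum_eq_single 0 ?_ (by simp)] at h3
      · rw [weightedCharSum_zero, weightedCharSum_zero, sub_zero, mul_eq_zero, or_iff_left hr,
          ← mul_sub, mul_eq_zero, or_iff_right hn0, add_sub_add_right_eq_sub, sub_eq_zero] at h3
        have h4 : s j = s i := by exact_mod_cast h3
        rw [h4] at hj'
        exact hm (by linear_combination hj')
      · intro k _ hk
        by_cases hk' : Y (r - k) r = 0
        · rw [hk', mul_zero]
        · rw [weightedCharSum_eq_div _ hk, weightedCharSum_eq_div _ hk, hj',
            show k * ((s i : ZMod n) - m) = k * s i + -(k * m) by ring,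
            AddChar.map_add_eq_mul, hchar k hk', mul_one, sub_self, zero_mul]
    have hconst (a : ZMod n) : Y a a = (n : ℂ)⁻¹ * ZMod.dft (fun b => Y b b) 0 := by
      have h1 := congrFun ((ZMod.dft (N := n) (E := ℂ)).symm_apply_apply fun b => Y b b) a
      rw [ZMod.invDFT_apply, Finset.sum_eq_single 0 (fun k _ hk => by rw [hdft k hk, smul_zero])
        (by simp)] at h1
      simpa using h1.symm
    exact hr (by rw [hconst r, ← hconst 0, h00])
  ext a b
  have h1 := eq_zero_of_sum_weightedCharSum_mul hs (u := fun k => Y (b - k) b)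
    (by simpa using hdiag b) (fun i => hcol' i b)
  simpa using congrFun h1 (b - a)

end WeightedCharSum


section ExpSum

/-- The function `z ↦ ∑ exp (t * z)`, summed over `s ≤ t < s + n`. -/
noncomputable def expSum (n : ℕ) (s : ℤ) (z : ℂ) : ℂ :=
  ∑ p : Fin n, Complex.exp (((s + (p : ℕ) : ℤ) : ℂ) * z)

/-- The derivative of `expSum n s`. -/
noncomputable def expSumDeriv (n : ℕ) (s : ℤ) (z : ℂ) : ℂ :=
  ∑ p : Fin n, ((s + (p : ℕ) : ℤ) : ℂ) * Complex.exp (((s + (p : ℕ) : ℤ) : ℂ) * z)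

theorem hasDerivAt_expSum (n : ℕ) (s : ℤ) (z : ℂ) :
    HasDerivAt (expSum n s) (expSumDeriv n s z) z := by
  refine HasDerivAt.fun_sum fun p _ => ?_
  have := ((hasDerivAt_id z).const_mul ((s + (p : ℕ) : ℤ) : ℂ)).cexp
  simpa [mul_comm] using this

theorem contDiff_expSum (n : ℕ) (s : ℤ) : ContDiff ℂ 1 (expSum n s) :=
  ContDiff.sum fun _ _ => (contDiff_const.mul contDiff_id).cexp

variable {n : ℕ} [NeZero n]

/-- The logarithm `2 * π * I * a / n` of an `n`-th root of unity. -/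
noncomputable def logRoot (n : ℕ) (a : Fin n) : ℂ :=
  2 * Real.pi * Complex.I * (a : ℕ) / n

theorem logRoot_zero : logRoot n 0 = 0 := by simp [logRoot]

theorem exp_mul_logRoot_sub (t : ℤ) (a b : Fin n) :
    Complex.exp (t * (logRoot n b - logRoot n a)) =
      ZMod.stdAddChar ((((b : ℕ) : ZMod n) - ((a : ℕ) : ZMod n)) * (t : ZMod n)) := by
  have : (((b : ℕ) : ZMod n) - ((a : ℕ) : ZMod n)) * (t : ZMod n) =
      ((((b : ℕ) - (a : ℕ)) * t : ℤ) : ZMod n) := by push_cast; rfl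
  rw [this, ZMod.stdAddChar_coe, logRoot, logRoot]
  congr 1
  push_cast
  ring

theorem expSumDeriv_logRoot (s : ℤ) (a b : Fin n) :
    expSumDeriv n s (logRoot n b - logRoot n a) =
      weightedCharSum n s (((b : ℕ) : ZMod n) - ((a : ℕ) : ZMod n)) := by
  simp only [expSumDeriv, weightedCharSum, exp_mul_logRoot_sub]

theorem finCast_injective : Function.Injective fun a : Fin n => ((a : ℕ) : ZMod n) := by
  have := (bijective_intCast_add (n := n) 0).1
  simpa using this

theorem expSum_logRoot (s : ℤ) (a b : Fin n) :
    expSum n s (logRoot n b - logRoot n a) = if a = b then (n : ℂ) else 0 := by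
  split_ifs with h
  · simp [expSum, h]
  · simp only [expSum, exp_mul_logRoot_sub]
    rw [(bijective_intCast_add s).sum_comp fun c =>
      ZMod.stdAddChar ((((b : ℕ) : ZMod n) - ((a : ℕ) : ZMod n)) * c)]
    exact sum_stdAddChar_mul (sub_ne_zero.mpr fun h' => h (finCast_injective h'.symm))

/-- The reduction bijection between `Fin n` and `ZMod n`. -/
noncomputable def finEquivZMod (n : ℕ) [NeZero n] : Fin n ≃ ZMod n :=
  Equiv.ofBijective (fun a : Fin n => ((a : ℕ) : ZMod n))
    ((Fintype.bijective_iff_injective_and_card _).mpr ⟨finCast_injective, by simp [ZMod.card]⟩)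

omit [NeZero n] in
theorem exists_nonroot {ι : Type*} [Fintype ι] {P : ι → Polynomial ℂ} (hP : ∀ i, P i ≠ 0) :
    ∃ w : ℂ, w ≠ 0 ∧ ∀ i, (P i).eval w ≠ 0 := by
  have h : Polynomial.X * ∏ i, P i ≠ 0 :=
    mul_ne_zero Polynomial.X_ne_zero (Finset.prod_ne_zero_iff.mpr fun i _ => hP i)
  obtain ⟨w, hw⟩ : ∃ w, (Polynomial.X * ∏ i, P i).eval w ≠ 0 := by
    by_contra! hcon
    exact h (Polynomial.funext fun w => by simpa using hcon w)
  rw [Polynomial.eval_mul, Polynomial.eval_X, Polynomial.eval_prod] at hw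
  exact ⟨w, left_ne_zero_of_mul hw,
    fun i => Finset.prod_ne_zero_iff.mp (right_ne_zero_of_mul hw) i (Finset.mem_univ i)⟩

omit [NeZero n] in
theorem exists_polynomial_expSumDeriv_add (hn : 2 ≤ n) (s : ℤ) (v d : ℂ) :
    ∃ P : Polynomial ℂ, P ≠ 0 ∧ ∀ τ : ℂ, expSumDeriv n s (τ + v) = d →
      P.eval (Complex.exp τ) = 0 := by
  obtain ⟨p₀, hp₀, hsp⟩ : ∃ p₀ : ℕ, p₀ < n ∧ s + p₀ ≠ 0 := by
    by_cases hs : s = 0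
    · exact ⟨1, by omega, by omega⟩
    · exact ⟨0, by omega, by simpa using hs⟩
  refine ⟨∑ p : Fin n, Polynomial.C (((s + (p : ℕ) : ℤ) : ℂ) *
    Complex.exp (((s + (p : ℕ) : ℤ) : ℂ) * v)) * Polynomial.X ^ ((p : ℕ) + s.toNat) -
      Polynomial.C d * Polynomial.X ^ (-s).toNat, fun h => ?_, fun τ hτ => ?_⟩
  · have h1 := congrArg (fun P => Polynomial.coeff P (p₀ + s.toNat)) h
    simp only [Polynomial.coeff_sub, Polynomial.finsetSum_coeff, Polynomial.coeff_C_mul,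
      Polynomial.coeff_X_pow, Polynomial.coeff_zero] at h1
    rw [if_neg (show ¬ (p₀ + s.toNat = (-s).toNat) by omega),
      Finset.sum_eq_single (⟨p₀, hp₀⟩ : Fin n)] at h1
    · have h2 : ((s + (p₀ : ℕ) : ℤ) : ℂ) ≠ 0 := by exact_mod_cast hsp
      simp only [if_true, mul_one, mul_zero, sub_zero, mul_eq_zero, Complex.exp_ne_zero,
        or_false] at h1
      exact h2 h1
    · intro p _ hp
      rw [if_neg, mul_zero]
      exact fun h => hp (Fin.ext (by simpa using h.symm))
    · simp
  · rw [Polynomial.eval_sub, Polynomial.eval_finsetSum, sub_eq_zero, ← hτ, expSumDeriv]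
    simp only [Polynomial.eval_mul, Polynomial.eval_C, Polynomial.eval_pow, Polynomial.eval_X]
    rw [Finset.sum_mul]
    refine Finset.sum_congr rfl fun p _ => ?_
    rw [mul_assoc, mul_assoc, ← Complex.exp_nat_mul, ← Complex.exp_nat_mul, ← Complex.exp_add,
      ← Complex.exp_add]
    congr 2
    have h3 : ((s.toNat : ℤ) : ℂ) = s + (((-s).toNat : ℤ) : ℂ) := by
      rw [← Int.cast_add]
      congr 1
      omega
    push_cast at h3 ⊢
    rw [h3]
    ring

theorem exists_expSum_ne (hn : 2 ≤ n) (s : ℤ) :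
    ∃ τ : ℂ, expSum n s τ ≠ 0 ∧
      ∀ a, expSumDeriv n s (τ - logRoot n a) ≠ expSumDeriv n s (-logRoot n a) := by
  choose P hP hP' using fun a : Fin n =>
    exists_polynomial_expSumDeriv_add hn s (-logRoot n a) (expSumDeriv n s (-logRoot n a))
  obtain ⟨w, hw, hPw⟩ := exists_nonroot (P := fun a : Option (Fin n) =>
    a.elim (∑ p : Fin n, Polynomial.X ^ (p : ℕ)) P) (by
      rintro (_ | a)
      · intro h
        have h1 := congrArg (fun P => Polynomial.coeff P 0) h
        simp only [Option.elim_none, Polynomial.finsetSum_coeff, Polynomial.coeff_X_pow,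
          Polynomial.coeff_zero] at h1
        rw [Finset.sum_eq_single (0 : Fin n)] at h1
        · simp at h1
        · intro p _ hp
          rw [if_neg]
          exact fun h => hp (Fin.ext (by simpa using h.symm))
        · simp
      · exact hP a)
  refine ⟨Complex.log w, fun h => ?_, fun a h => ?_⟩
  · have h1 := hPw none
    simp only [Option.elim_none, Polynomial.eval_finsetSum, Polynomial.eval_pow,
      Polynomial.eval_X] at h1
    have h2 : expSum n s (Complex.log w) =
        Complex.exp (s * Complex.log w) * ∑ p : Fin n, w ^ (p : ℕ) := by
      rw [expSum, Finset.mul_sum]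
      refine Finset.sum_congr rfl fun p _ => ?_
      conv_rhs => rw [← Complex.exp_log hw, ← Complex.exp_nat_mul, Complex.log_exp
        (Complex.neg_pi_lt_log_im w) (Complex.log_im_le_pi w), ← Complex.exp_add]
      congr 1
      push_cast
      ring
    rw [h2] at h
    exact h1 ((mul_eq_zero.mp h).resolve_left (Complex.exp_ne_zero _))
  · refine hPw (some a) ?_
    have := hP' a (Complex.log w) (by rwa [← sub_eq_add_neg])
    rwa [Complex.exp_log hw] at this

variable {s : Fin n → ℤ} (hs : ∀ i j : Fin n, i ≠ j → ¬ ((n : ℤ) ∣ (s i - s j)))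
include hs

theorem eq_zero_of_column_relations {Z : Fin n → Fin n → ℂ}
    (hsum : ∑ i, (s i : ℂ) + n * ((n : ℂ) - 1) / 2 ≠ 0)
    (h : ∀ i b : Fin n, ∑ a : Fin n,
      weightedCharSum n (s i) (((b : ℕ) : ZMod n) - ((a : ℕ) : ZMod n)) * Z a b = 0) :
    Z = 0 := by
  have key (b : Fin n) := eq_zero_of_sum_weightedCharSum_mul_of_sum_ne_zero hs hsum
    (u := fun k => Z ((finEquivZMod n).symm (((b : ℕ) : ZMod n) - k)) b) (fun i => by
      rw [← h i b, ← Equiv.sum_comp ((finEquivZMod n).trans (Equiv.subLeft ((b : ℕ) : ZMod n)))]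
      refine Finset.sum_congr rfl fun a _ => ?_
      simp only [Equiv.trans_apply, Equiv.subLeft_apply, sub_sub_cancel, Equiv.symm_apply_apply]
      rfl)
  ext a b
  have := congrFun (key b) (((b : ℕ) : ZMod n) - finEquivZMod n a)
  simpa using this

theorem eq_zero_of_perturbed_relations (hn : 2 ≤ n) {Z G H : Fin n → Fin n → ℂ}
    (hsum : ∑ i, (s i : ℂ) + n * ((n : ℂ) - 1) / 2 = 0)
    (hG : ∀ a c : Fin n, c ≠ 0 → G a c = if a = c then (n : ℂ) else 0) (hG0 : G 0 0 ≠ 0)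
    (hH : ∀ a b : Fin n, b ≠ 0 →
      H a b = weightedCharSum n (s 0) (((b : ℕ) : ZMod n) - ((a : ℕ) : ZMod n)))
    (hH0 : ∀ a : Fin n, H a 0 ≠
      weightedCharSum n (s 0) ((((0 : Fin n) : ℕ) : ZMod n) - ((a : ℕ) : ZMod n)))
    (hcol : ∀ i b : Fin n, i ≠ 0 → ∑ c : Fin n, weightedCharSum n (s i)
      (((b : ℕ) : ZMod n) - ((c : ℕ) : ZMod n)) * ∑ a, G a c * Z a b = 0)
    (hrow : ∀ i c : Fin n, i ≠ 0 → ∑ b : Fin n, weightedCharSum n (s i)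
      (((b : ℕ) : ZMod n) - ((c : ℕ) : ZMod n)) * ∑ a, G a c * Z a b = 0)
    (hlast : ∀ a, ∑ b, H a b * Z a b = 0) : Z = 0 := by
  have hn0 : (n : ℂ) ≠ 0 := NeZero.ne _
  set Y : Fin n → Fin n → ℂ := fun c b => ∑ a, G a c * Z a b with hYdef
  have hYne (c b : Fin n) (hc : c ≠ 0) : Y c b = n * Z c b := by
    simp only [hYdef, hG _ c hc, ite_mul, zero_mul, Finset.sum_ite_eq', Finset.mem_univ, if_true]
  have htot (k : ZMod n) : ∑ i, weightedCharSum n (s i) k = 0 := by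
    rcases eq_or_ne k 0 with rfl | hk
    · rw [sum_weightedCharSum_zero, hsum, mul_zero]
    · exact sum_weightedCharSum_of_ne_zero hs hk
  have hextend {f : Fin n → ZMod n} {g : Fin n → ℂ}
      (h : ∀ i, i ≠ 0 → ∑ c, weightedCharSum n (s i) (f c) * g c = 0) (i : Fin n) :
      ∑ c, weightedCharSum n (s i) (f c) * g c = 0 := by
    rcases eq_or_ne i 0 with rfl | hi
    · rw [← Finset.sum_eq_single (f := fun i => ∑ c, weightedCharSum n (s i) (f c) * g c)
        (s := Finset.univ) (0 : Fin n) (fun i _ hi => h i hi) (by simp), Finset.sum_comm]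
      simp [← Finset.sum_mul, htot]
    · exact h i hi
  have hcol' (i b : Fin n) := hextend (fun i hi => hcol i b hi) i
  have hrow' (i c : Fin n) := hextend (fun i hi => hrow i c hi) i
  have hY0 (a : Fin n) (ha : a ≠ 0) : Y a 0 = 0 := by
    have h1 := hrow' 0 a
    have h2 : ∑ b : Fin n, (H a b - weightedCharSum n (s 0)
        (((b : ℕ) : ZMod n) - ((a : ℕ) : ZMod n))) * Y a b = 0 := by
      simp only [sub_mul, Finset.sum_sub_distrib]
      rw [h1, sub_zero]
      simp only [hYne a _ ha, mul_left_comm _ (n : ℂ), ← Finset.mul_sum, hlast, mul_zero]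
    rw [Finset.sum_eq_single 0 (fun b _ hb => by rw [hH a b hb, sub_self, zero_mul])
      (by simp)] at h2
    exact (mul_eq_zero.mp h2).resolve_left (sub_ne_zero.mpr (hH0 a))
  let e := finEquivZMod n
  have he (a : Fin n) : e a = ((a : ℕ) : ZMod n) := rfl
  have hYz : (fun a b => Y (e.symm a) (e.symm b)) = 0 := by
    refine eq_zero_of_row_column_relations hs hn (fun i b => ?_) (fun i a => ?_) fun a ha => ?_
    · rw [← hcol' i (e.symm b), ← Equiv.sum_comp e]
      simp only [← he, Equiv.symm_apply_apply, Equiv.apply_symm_apply]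
      rfl
    · rw [← hrow' i (e.symm a), ← Equiv.sum_comp e]
      simp only [← he, Equiv.symm_apply_apply, Equiv.apply_symm_apply]
      rfl
    · have h0 : e 0 = 0 := by simp [he]
      have h0' : e.symm 0 = 0 := by rw [← h0, Equiv.symm_apply_apply]
      rw [h0']
      refine hY0 _ fun h => ha ?_
      rw [← e.apply_symm_apply a, h, h0]
  have hY (c b : Fin n) : Y c b = 0 := by
    have := congrFun (congrFun hYz (e c)) (e b)
    simpa using this
  have hZne (c b : Fin n) (hc : c ≠ 0) : Z c b = 0 := by
    have := hY c b
    rw [hYne c b hc] at this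
    exact (mul_eq_zero.mp this).resolve_left hn0
  ext c b
  rcases eq_or_ne c 0 with rfl | hc
  · have h1 : ∑ a, G a 0 * Z a b = 0 := hY 0 b
    rw [Finset.sum_eq_single 0 (fun a _ ha => by rw [hZne a b ha, mul_zero]) (by simp)] at h1
    exact (mul_eq_zero.mp h1).resolve_left hG0
  · exact hZne c b hc

end ExpSum

section Surjectivity

theorem prod_ofFn_smul_one {R : Type*} [Ring R] [Algebra ℂ R] {n : ℕ} (c : ℂ) (f : Fin n → R)
    (i : Fin n) (hf : ∀ j, j ≠ i → f j = c • 1) :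
    (List.ofFn f).prod = c ^ (n - 1) • f i := by
  induction n with
  | zero => exact i.elim0
  | succ n ih =>
    rw [List.ofFn_succ, List.prod_cons]
    rcases Fin.eq_zero_or_eq_succ i with rfl | ⟨j, rfl⟩
    · have h : (fun j : Fin n => f j.succ) = fun _ => c • (1 : R) :=
        funext fun j => hf _ (Fin.succ_ne_zero j)
      rw [h, List.ofFn_const, List.prod_replicate, smul_pow, one_pow]
      simp
    · rw [hf 0 (Fin.succ_ne_zero j).symm,
        ih (fun j => f j.succ) j fun k hk => hf _ fun h => hk (Fin.succ_injective _ h)]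
      obtain ⟨m, rfl⟩ : ∃ m, n = m + 1 := ⟨n - 1, by have := j.isLt; omega⟩
      simp [smul_smul, pow_succ', mul_comm]

theorem prod_ofFn_smul_one_of_ne_zero {R : Type*} [Ring R] [Algebra ℂ R] {n : ℕ} [NeZero n]
    (c : ℂ) (f : Fin n → R) (i : Fin n) (hi : i ≠ 0) (hf : ∀ j, j ≠ 0 → j ≠ i → f j = c • 1) :
    (List.ofFn f).prod = c ^ (n - 2) • (f 0 * f i) := by
  obtain ⟨m, rfl⟩ : ∃ m, n = m + 1 := ⟨n - 1, by have := i.isLt; omega⟩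
  obtain ⟨j, rfl⟩ := Fin.exists_succ_eq.mpr hi
  rw [List.ofFn_succ, List.prod_cons, prod_ofFn_smul_one c (fun j => f j.succ) j fun k hk =>
    hf _ (Fin.succ_ne_zero k) fun h => hk (Fin.succ_injective _ h), mul_smul_comm]
  rfl

theorem contDiff_prod_ofFn {E : Type*} [NormedAddCommGroup E] [NormedSpace ℂ E] {ι : Type*}
    [Fintype ι] [DecidableEq ι] {m : ℕ} (F : Fin m → E → Matrix ι ι ℂ)
    (hF : ∀ i a b, ContDiff ℂ 1 fun θ => F i θ a b) (a b : ι) :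
    ContDiff ℂ 1 fun θ => (List.ofFn fun i => F i θ).prod a b := by
  induction m generalizing a b with
  | zero => simpa using contDiff_const
  | succ m ih =>
    simp only [List.ofFn_succ, List.prod_cons, Matrix.mul_apply]
    exact ContDiff.sum fun c _ => (hF 0 a c).mul (ih (fun i => F i.succ) (fun i => hF i.succ) c b)

variable {n : ℕ}

/-- The matrix with entries `expSum n s (y a + x b)`. -/
noncomputable def expMatrix (s : ℤ) (y x : Fin n → ℂ) : Matrix (Fin n) (Fin n) ℂ :=
  Matrix.of fun a b => expSum n s (y a + x b)

/-- The product of the matrices `expMatrix (s i) (y i) (x i)`, as a function of `(y, x)`. -/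
noncomputable def expProd (s : Fin n → ℤ) (θ : (Fin n → Fin n → ℂ) × (Fin n → Fin n → ℂ)) :
    Fin n → Fin n → ℂ :=
  (List.ofFn fun i => expMatrix (s i) (θ.1 i) (θ.2 i)).prod

theorem contDiff_expProd (s : Fin n → ℤ) : ContDiff ℂ 1 (expProd s) := by
  have h := contDiff_prod_ofFn (E := (Fin n → Fin n → ℂ) × (Fin n → Fin n → ℂ))
    (fun i θ => expMatrix (s i) (θ.1 i) (θ.2 i)) (fun i a b => ?_)
  · exact contDiff_pi.mpr fun a => contDiff_pi.mpr fun b => h a b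
  have h1 : ContDiff ℂ 1 fun θ : (Fin n → Fin n → ℂ) × (Fin n → Fin n → ℂ) => θ.1 i a :=
    (contDiff_apply_apply ℂ ℂ i a).comp contDiff_fst
  have h2 : ContDiff ℂ 1 fun θ : (Fin n → Fin n → ℂ) × (Fin n → Fin n → ℂ) => θ.2 i b :=
    (contDiff_apply_apply ℂ ℂ i b).comp contDiff_snd
  exact (contDiff_expSum n (s i)).comp (h1.add h2)

theorem mem_range_of_hasDerivAt_line {E F : Type*} [NormedAddCommGroup E] [NormedSpace ℂ E]
    [NormedAddCommGroup F] [NormedSpace ℂ F] {f : E → F} {L : E →L[ℂ] F} {x v : E} {D : F}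
    (hf : HasFDerivAt f L x) (hD : HasDerivAt (fun ε : ℂ => f (x + ε • v)) D 0) :
    D ∈ LinearMap.range L.toLinearMap := by
  have h1 : HasDerivAt (fun ε : ℂ => x + ε • v) v 0 := by
    simpa using ((hasDerivAt_id (0 : ℂ)).smul_const v).const_add x
  have h2 : HasFDerivAt f L (x + (0 : ℂ) • v) := by simpa using hf
  exact ⟨v, (h2.comp_hasDerivAt 0 h1).unique hD⟩

variable [NeZero n]

theorem expMatrix_logRoot (s : ℤ) :
    expMatrix s (fun a => -logRoot n a) (logRoot n) = (n : ℂ) • 1 := by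
  ext a b
  simp only [expMatrix, Matrix.of_apply, neg_add_eq_sub, expSum_logRoot, Matrix.smul_apply,
    Matrix.one_apply, smul_eq_mul, mul_ite, mul_one, mul_zero]

/-- The parameters `y i a = -logRoot n a` and `x i b = logRoot n b`, with `x 0` replaced by `ξ`. -/
noncomputable def basePoint (ξ : Fin n → ℂ) : (Fin n → Fin n → ℂ) × (Fin n → Fin n → ℂ) :=
  (fun _ a => -logRoot n a, Function.update (fun _ => logRoot n) 0 ξ)

omit [NeZero n] in
theorem hasDerivAt_expMatrix (s : ℤ) (y x vy vx : Fin n → ℂ) (a b : Fin n) :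
    HasDerivAt (fun ε : ℂ => expMatrix s (y + ε • vy) (x + ε • vx) a b)
      (expSumDeriv n s (y a + x b) * (vy a + vx b)) 0 := by
  have h1 : HasDerivAt (fun ε : ℂ => (y a + ε * vy a) + (x b + ε * vx b)) (vy a + vx b) 0 := by
    simpa using (((hasDerivAt_id' (0 : ℂ)).mul_const (vy a)).const_add (y a)).fun_add
      (((hasDerivAt_id' (0 : ℂ)).mul_const (vx b)).const_add (x b))
  have h2 : HasDerivAt (expSum n s) (expSumDeriv n s (y a + x b))
      ((y a + 0 * vy a) + (x b + 0 * vx b)) := by simpa using hasDerivAt_expSum n s (y a + x b)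
  exact h2.comp 0 h1

variable {s : Fin n → ℤ} {ξ : Fin n → ℂ}
  {L : (Fin n → Fin n → ℂ) × (Fin n → Fin n → ℂ) →L[ℂ] (Fin n → Fin n → ℂ)}

theorem mem_range_fderiv_expProd_zero (hL : HasFDerivAt (expProd s) L (basePoint ξ))
    (vy vx : Fin n → ℂ) :
    (fun a b => expSumDeriv n (s 0) (-logRoot n a + ξ b) * (vy a + vx b)) ∈
      LinearMap.range L.toLinearMap := by
  have hn0 : (n : ℂ) ^ (n - 1) ≠ 0 := pow_ne_zero _ (NeZero.ne _)
  rw [← Submodule.smul_mem_iff _ hn0]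
  refine mem_range_of_hasDerivAt_line (v := (Pi.single 0 vy, Pi.single 0 vx)) hL ?_
  refine hasDerivAt_pi.mpr fun a => hasDerivAt_pi.mpr fun b => ?_
  refine ((hasDerivAt_expMatrix (s 0) (fun a => -logRoot n a) ξ vy vx a b).const_mul
    ((n : ℂ) ^ (n - 1))).congr_of_eventuallyEq (.of_forall fun ε => ?_)
  simp only [expProd]
  rw [prod_ofFn_smul_one (n : ℂ) _ 0 fun j hj => ?_]
  · simp [basePoint]
  · simpa [basePoint, hj] using expMatrix_logRoot (s j)

theorem mem_range_fderiv_expProd (hL : HasFDerivAt (expProd s) L (basePoint ξ)) {i : Fin n}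
    (hi : i ≠ 0) (vy vx : Fin n → ℂ) :
    (fun a b : Fin n => ∑ c : Fin n, expSum n (s 0) (-logRoot n a + ξ c) *
      (weightedCharSum n (s i) (((b : ℕ) : ZMod n) - ((c : ℕ) : ZMod n)) * (vy c + vx b))) ∈
      LinearMap.range L.toLinearMap := by
  have hn0 : (n : ℂ) ^ (n - 2) ≠ 0 := pow_ne_zero _ (NeZero.ne _)
  rw [← Submodule.smul_mem_iff _ hn0]
  refine mem_range_of_hasDerivAt_line (v := (Pi.single i vy, Pi.single i vx)) hL ?_
  refine hasDerivAt_pi.mpr fun a => hasDerivAt_pi.mpr fun b => ?_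
  have hC (c : Fin n) : weightedCharSum n (s i) (((b : ℕ) : ZMod n) - ((c : ℕ) : ZMod n)) =
      expSumDeriv n (s i) (-logRoot n c + logRoot n b) := by
    rw [← expSumDeriv_logRoot, neg_add_eq_sub]
  simp only [Pi.smul_apply, smul_eq_mul, hC]
  have h1 := HasDerivAt.fun_sum (u := Finset.univ) fun c _ =>
    (hasDerivAt_expMatrix (s i) (fun a => -logRoot n a) (logRoot n) vy vx c b).const_mul
      (expSum n (s 0) (-logRoot n a + ξ c))
  refine (h1.const_mul ((n : ℂ) ^ (n - 2))).congr_of_eventuallyEq (.of_forall fun ε => ?_)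
  simp only [expProd]
  rw [prod_ofFn_smul_one_of_ne_zero (n : ℂ) _ i hi fun j hj hj' => ?_]
  · simp [basePoint, hi, hi.symm, Matrix.mul_apply]
    exact .inl rfl
  · simpa [basePoint, hj, hj'] using expMatrix_logRoot (s j)

omit [NeZero n] in
theorem linearMap_apply_eq_sum (f : (Fin n → Fin n → ℂ) →ₗ[ℂ] ℂ) (D : Fin n → Fin n → ℂ) :
    f D = ∑ a, ∑ b, D a b * f (Pi.single a (Pi.single b 1)) := by
  have h : D = ∑ a, ∑ b, D a b • (Pi.single a (Pi.single b 1) : Fin n → Fin n → ℂ) := by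
    ext a b
    simp [Finset.sum_apply, Pi.single_apply, ite_apply]
  conv_lhs => rw [h]
  simp only [map_sum, map_smul, smul_eq_mul]

omit [NeZero n] in
theorem range_eq_top_of_annihilator {E : Type*} [AddCommGroup E] [Module ℂ E]
    (L : E →ₗ[ℂ] (Fin n → Fin n → ℂ))
    (h : ∀ Z : Fin n → Fin n → ℂ,
      (∀ D ∈ LinearMap.range L, ∑ a, ∑ b, D a b * Z a b = 0) → Z = 0) :
    LinearMap.range L = ⊤ := by
  by_contra hne
  obtain ⟨f, hf, hle⟩ := Submodule.exists_le_ker_of_lt_top _ (lt_top_iff_ne_top.mpr hne)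
  refine hf (LinearMap.ext fun D => ?_)
  have hZ := h (fun a b => f (Pi.single a (Pi.single b 1))) fun D hD => by
    rw [← linearMap_apply_eq_sum]
    exact hle hD
  rw [linearMap_apply_eq_sum]
  simp [fun a b => congrFun (congrFun hZ a) b]

theorem exists_range_fderiv_expProd_eq_top
    (hs : ∀ i j : Fin n, i ≠ j → ¬ ((n : ℤ) ∣ (s i - s j))) (hsum : ∑ i, s i ≠ 0) :
    ∃ ξ : Fin n → ℂ, ∀ L : (Fin n → Fin n → ℂ) × (Fin n → Fin n → ℂ) →L[ℂ] (Fin n → Fin n → ℂ),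
      HasFDerivAt (expProd s) L (basePoint ξ) → LinearMap.range L.toLinearMap = ⊤ := by
  have hn0 : (n : ℂ) ≠ 0 := NeZero.ne _
  have hcol {ξ : Fin n → ℂ}
      {L : (Fin n → Fin n → ℂ) × (Fin n → Fin n → ℂ) →L[ℂ] (Fin n → Fin n → ℂ)}
      (hL : HasFDerivAt (expProd s) L (basePoint ξ)) {Z : Fin n → Fin n → ℂ}
      (hZ : ∀ D ∈ LinearMap.range L.toLinearMap, ∑ a, ∑ b, D a b * Z a b = 0) (i b : Fin n)
      (hi : i ≠ 0) : ∑ c : Fin n, weightedCharSum n (s i) (((b : ℕ) : ZMod n) - ((c : ℕ) : ZMod n)) *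
        ∑ a : Fin n, expSum n (s 0) (-logRoot n a + ξ c) * Z a b = 0 := by
    have h := hZ _ (mem_range_fderiv_expProd hL hi 0 (Pi.single b 1))
    simp only [Pi.zero_apply, zero_add, Pi.single_apply, mul_ite, mul_one, mul_zero,
      Finset.sum_ite_irrel, Finset.sum_const_zero, ite_mul, zero_mul, Finset.sum_ite_eq',
      Finset.mem_univ, if_true] at h
    simp only [Finset.sum_mul] at h
    rw [Finset.sum_comm] at h
    rw [← h]
    refine Finset.sum_congr rfl fun c _ => ?_
    rw [Finset.mul_sum]
    exact Finset.sum_congr rfl fun a _ => by ring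
  by_cases hsum' : ∑ i, (s i : ℂ) + n * ((n : ℂ) - 1) / 2 = 0
  · have hn : 2 ≤ n := by
      by_contra! hlt
      have hn1 : n = 1 := by have := NeZero.pos n; omega
      subst hn1
      refine hsum ?_
      have : ∑ i, (s i : ℂ) = 0 := by simpa using hsum'
      exact_mod_cast this
    obtain ⟨τ, hτ, hτ'⟩ := exists_expSum_ne hn (s 0)
    refine ⟨Function.update (logRoot n) 0 τ, fun L hL =>
      range_eq_top_of_annihilator _ fun Z hZ => ?_⟩
    refine eq_zero_of_perturbed_relations hs hn (Z := Z)
      (G := fun a b => expSum n (s 0) (-logRoot n a + Function.update (logRoot n) 0 τ b))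
      (H := fun a b => expSumDeriv n (s 0) (-logRoot n a + Function.update (logRoot n) 0 τ b))
      hsum' (fun a c hc => ?_) ?_ (fun a b hb => ?_) (fun a => ?_)
      (fun i b hi => hcol hL hZ i b hi) (fun i c hi => ?_) (fun a => ?_)
    · rw [Function.update_of_ne hc, neg_add_eq_sub, expSum_logRoot]
    · simpa [logRoot_zero] using hτ
    · rw [Function.update_of_ne hb, neg_add_eq_sub, expSumDeriv_logRoot]
    · rw [Function.update_self, neg_add_eq_sub, ← expSumDeriv_logRoot, logRoot_zero, zero_sub]
      exact hτ' a
    · have h := hZ _ (mem_range_fderiv_expProd hL hi (Pi.single c 1) 0)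
      simp only [Pi.zero_apply, add_zero, Pi.single_apply, mul_ite, mul_one, mul_zero,
        Finset.sum_ite_eq', Finset.mem_univ, if_true] at h
      rw [Finset.sum_comm] at h
      rw [← h]
      refine Finset.sum_congr rfl fun b _ => ?_
      rw [Finset.mul_sum]
      exact Finset.sum_congr rfl fun a _ => by ring
    · have h := hZ _ (mem_range_fderiv_expProd_zero hL (Pi.single a 1) 0)
      simpa [Pi.single_apply, ite_mul, Finset.sum_ite_irrel] using h
  · refine ⟨logRoot n, fun L hL => range_eq_top_of_annihilator _ fun Z hZ => ?_⟩
    refine eq_zero_of_column_relations hs hsum' fun i b => ?_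
    rcases eq_or_ne i 0 with rfl | hi
    · have h := hZ _ (mem_range_fderiv_expProd_zero hL 0 (Pi.single b 1))
      simpa [Pi.single_apply, neg_add_eq_sub, expSumDeriv_logRoot] using h
    · have h := hcol hL hZ i b hi
      simp only [neg_add_eq_sub, expSum_logRoot, ite_mul, zero_mul, Finset.sum_ite_eq',
        Finset.mem_univ, if_true, mul_left_comm _ (n : ℂ)] at h
      rw [← Finset.mul_sum] at h
      exact (mul_eq_zero.mp h).resolve_left hn0

theorem exists_eventually_expProd_eq
    (hs : ∀ i j : Fin n, i ≠ j → ¬ ((n : ℤ) ∣ (s i - s j))) (hsum : ∑ i, s i ≠ 0) :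
    ∃ X₀, ∀ᶠ X in 𝓝 X₀, ∃ θ, expProd s θ = X := by
  obtain ⟨ξ, hξ⟩ := exists_range_fderiv_expProd_eq_top hs hsum
  have h := (contDiff_expProd s).hasStrictFDerivAt (x := basePoint ξ) one_ne_zero
  refine ⟨expProd s (basePoint ξ), ?_⟩
  rw [← h.map_nhds_eq_of_surj (hξ _ h.hasFDerivAt)]
  exact Filter.eventually_map.mpr (.of_forall fun θ => ⟨θ, rfl⟩)

end Surjectivity

section Units

/-- The generalized Vandermonde matrix of type `s` with nodes `x`, over a commutative ring. -/
def unitVandermonde {R : Type*} [CommRing R] {n : ℕ} (s : ℤ) (x : Fin n → Rˣ) :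
    Matrix (Fin n) (Fin n) R :=
  Matrix.of fun p q => ((x q ^ (s + (p : ℕ)) : Rˣ) : R)

/-- The product of the matrices `Bᵢ Aᵢ`, where `Aᵢ` and the transpose of `Bᵢ` are generalized
Vandermonde matrices of type `s i` with nodes `x i` and `y i`. -/
def unitVandermondeProd {R : Type*} [CommRing R] {n : ℕ} (s : Fin n → ℤ)
    (y x : Fin n → Fin n → Rˣ) : Matrix (Fin n) (Fin n) R :=
  (List.ofFn fun i => (unitVandermonde (s i) (y i)).transpose * unitVandermonde (s i) (x i)).prod

variable {n : ℕ}

theorem map_unitVandermonde {R S : Type*} [CommRing R] [CommRing S] (φ : R →+* S) (s : ℤ)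
    (x : Fin n → Rˣ) :
    φ.mapMatrix (unitVandermonde s x) =
      unitVandermonde s fun q => Units.map (φ : R →* S) (x q) := by
  ext p q
  simp only [unitVandermonde, RingHom.mapMatrix_apply, Matrix.map_apply, Matrix.of_apply,
    ← map_zpow]
  rfl

theorem map_unitVandermondeProd {R S : Type*} [CommRing R] [CommRing S] (φ : R →+* S)
    (s : Fin n → ℤ) (y x : Fin n → Fin n → Rˣ) :
    φ.mapMatrix (unitVandermondeProd s y x) =
      unitVandermondeProd s (fun i q => Units.map (φ : R →* S) (y i q))
        fun i q => Units.map (φ : R →* S) (x i q) := by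
  have hT (A : Matrix (Fin n) (Fin n) R) :
      φ.mapMatrix A.transpose = (φ.mapMatrix A).transpose := rfl
  simp only [unitVandermondeProd, map_list_prod, List.map_ofFn, Function.comp_def, map_mul, hT,
    map_unitVandermonde]

theorem isGenVandermonde_unitVandermonde (s : ℤ) (x : Fin n → ℂˣ) :
    IsGenVandermonde n s (unitVandermonde s x) :=
  ⟨fun q => x q, fun q => (x q).ne_zero, fun p q => by simp [unitVandermonde]⟩

/-- The exponential, as a unit. -/
noncomputable def expUnit (z : ℂ) : ℂˣ := Units.mk0 (Complex.exp z) (Complex.exp_ne_zero z)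

theorem expProd_eq_unitVandermondeProd (s : Fin n → ℤ)
    (θ : (Fin n → Fin n → ℂ) × (Fin n → Fin n → ℂ)) :
    expProd s θ = unitVandermondeProd s (fun i q => expUnit (θ.1 i q))
      fun i q => expUnit (θ.2 i q) := by
  have h (i : Fin n) : expMatrix (s i) (θ.1 i) (θ.2 i) =
      (unitVandermonde (s i) fun q => expUnit (θ.1 i q)).transpose *
        unitVandermonde (s i) fun q => expUnit (θ.2 i q) := by
    ext a b
    simp only [expMatrix, expSum, unitVandermonde, expUnit, Matrix.mul_apply, Matrix.of_apply,
      Matrix.transpose_apply, Units.val_zpow_eq_zpow_val, Units.val_mk0, ← Complex.exp_int_mul,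
      ← Complex.exp_add, mul_add]
  simp only [expProd, unitVandermondeProd, h]
  rfl

theorem exists_polynomial_unitVandermondeProd [NeZero n] {s : Fin n → ℤ}
    (hs : ∀ i j : Fin n, i ≠ j → ¬ ((n : ℤ) ∣ (s i - s j))) (hsum : ∑ i, s i ≠ 0) :
    ∃ g : MvPolynomial (Fin n × Fin n) ℂ, g ≠ 0 ∧ ∀ X : Matrix (Fin n) (Fin n) ℂ,
      MvPolynomial.eval (fun p => X p.1 p.2) g ≠ 0 → ∃ y x, X = unitVandermondeProd s y x := by
  obtain ⟨B, _, _, _, u, hu⟩ := exists_finiteType_algebra_units (Bool × Fin n × Fin n)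
  obtain ⟨X₀, hX₀⟩ := exists_eventually_expProd_eq hs hsum
  let F : Matrix (Fin n) (Fin n) B :=
    unitVandermondeProd s (fun i q => u (true, i, q)) fun i q => u (false, i, q)
  have hF (ψ : B →ₐ[ℂ] ℂ) (a b : Fin n) : ψ (F a b) =
      unitVandermondeProd s (fun i q => Units.map (ψ : B →* ℂ) (u (true, i, q)))
        (fun i q => Units.map (ψ : B →* ℂ) (u (false, i, q))) a b :=
    congrFun (congrFun (map_unitVandermondeProd (ψ : B →+* ℂ) s _ _) a) b
  have hcurry : Filter.Tendsto (fun (w : Fin n × Fin n → ℂ) a b => w (a, b))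
      (𝓝 fun p => X₀ p.1 p.2) (𝓝 X₀) :=
    (continuous_pi fun a => continuous_pi fun b => continuous_apply (a, b)).tendsto _
  obtain ⟨g, hg, hg'⟩ := exists_polynomial_of_eventually_exists_algHom
    (fun p : Fin n × Fin n => F p.1 p.2) (fun p => X₀ p.1 p.2) (by
      filter_upwards [hcurry.eventually hX₀] with w ⟨θ, hθ⟩
      obtain ⟨ψ, hψ⟩ := hu fun t => expUnit (if t.1 then θ.1 t.2.1 t.2.2 else θ.2 t.2.1 t.2.2)
      refine ⟨ψ, fun p => ?_⟩
      have hψ' (t : Bool × Fin n × Fin n) : Units.map (ψ : B →* ℂ) (u t) =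
          expUnit (if t.1 then θ.1 t.2.1 t.2.2 else θ.2 t.2.1 t.2.2) := Units.ext (hψ t)
      rw [hF, ← congrFun (congrFun hθ p.1) p.2, expProd_eq_unitVandermondeProd]
      simp only [hψ']
      rfl)
  refine ⟨g, hg, fun X hX => ?_⟩
  obtain ⟨ψ, hψ⟩ := hg' _ hX
  exact ⟨_, _, Matrix.ext fun a b => (hψ (a, b)).symm.trans (hF ψ a b)⟩

end Units

/-- If `s₁, …, sₙ` are integers, pairwise incongruent mod `n`, with nonzero
sum, then every invertible `n×n` complex matrix `M` can be written as
`M = B₁A₁⋯BₙAₙ · B′₁A′₁⋯B′ₙA′ₙ` where `Aᵢ, A′ᵢ` are generalized Vandermonde matrices of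
type `sᵢ` and `Bᵢ, B′ᵢ` are transposes of generalized Vandermonde matrices of type `sᵢ`. -/
theorem stmt19 (n : ℕ) (s : Fin n → ℤ)
    (hmod : ∀ i j : Fin n, i ≠ j → ¬ ((n : ℤ) ∣ (s i - s j)))
    (hsum : ∑ i, s i ≠ 0)
    (M : Matrix (Fin n) (Fin n) ℂ) (hM : IsUnit M) :
    ∃ A A' B B' : Fin n → Matrix (Fin n) (Fin n) ℂ,
      (∀ i, IsGenVandermonde n (s i) (A i)) ∧
      (∀ i, IsGenVandermonde n (s i) (A' i)) ∧
      (∀ i, IsGenVandermonde n (s i) ((B i).transpose)) ∧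
      (∀ i, IsGenVandermonde n (s i) ((B' i).transpose)) ∧
      M = (List.ofFn (fun i => B i * A i)).prod *
          (List.ofFn (fun i => B' i * A' i)).prod := by
  have : NeZero n := ⟨by rintro rfl; exact hsum (by simp)⟩
  obtain ⟨g, hg, hU⟩ := exists_polynomial_unitVandermondeProd hmod hsum
  obtain ⟨X, ⟨y, x, rfl⟩, X', ⟨y', x', rfl⟩, rfl⟩ :=
    exists_mul_eq_of_polynomial (U := {X | ∃ y x, X = unitVandermondeProd s y x}) hg hU hM
  exact ⟨fun i => unitVandermonde (s i) (x i), fun i => unitVandermonde (s i) (x' i),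
    fun i => (unitVandermonde (s i) (y i)).transpose,
    fun i => (unitVandermonde (s i) (y' i)).transpose,
    fun i => isGenVandermonde_unitVandermonde _ _, fun i => isGenVandermonde_unitVandermonde _ _,
    fun i => isGenVandermonde_unitVandermonde _ _, fun i => isGenVandermonde_unitVandermonde _ _,
    rfl⟩
end
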